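/- Let (α₁,β₁) and (α₂,β₂) be two pairs of parameters with α₁, α₂ ≥ 0 and β₁, β₂ > 0, and let N₁ and N₂ be the counting functions of the eigenvalues of the problems (α₁,β₁) and (α₂,β₂) respectively, i.e. Nᵢ(λ) is the number of eigenvalues of the problem (αᵢ,βᵢ) not exceeding λ. Then |N₁(λ) − N₂(λ)| ≤ 4 for every λ > 0; in particular, the leading term of the eigenvalue counting asymptotics does not depend on the choice of the boundary parameters α, β. -/

import Mathlib

open Set Filter

/-- First derivative on `[0,1]` (one-sided at the endpoints). -/
noncomputable def Y1 (y : ℝ → ℝ) : ℝ → ℝ := derivWithin y (Set.Icc 0 1)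
/-- Second derivative on `[0,1]`. -/
noncomputable def Y2 (y : ℝ → ℝ) : ℝ → ℝ := iteratedDerivWithin 2 y (Set.Icc 0 1)
/-- Third derivative on `[0,1]`. -/
noncomputable def Y3 (y : ℝ → ℝ) : ℝ → ℝ := iteratedDerivWithin 3 y (Set.Icc 0 1)

/-- `y` is a solution on `[0,1]` of `[y''' - λ P y]' + λ P y' = 0`:
`y ∈ C³[0,1]` and `y''' - λ P y` is (continuously) differentiable on `[0,1]`
with derivative `-λ P y'`. -/
def SolutionOn (P : ℝ → ℝ) (lam : ℝ) (y : ℝ → ℝ) : Prop :=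
  ContDiffOn ℝ 3 y (Set.Icc 0 1) ∧
  ∀ x ∈ Set.Icc (0:ℝ) 1,
    HasDerivWithinAt (fun t => Y3 y t - lam * P t * y t)
      (-(lam * P x * Y1 y x)) (Set.Icc 0 1) x

/-- `y` is not identically zero on `[0,1]`. -/
def Nontrivial01 (y : ℝ → ℝ) : Prop := ∃ x ∈ Set.Icc (0:ℝ) 1, y x ≠ 0

/-- The boundary conditions of the problem `(α, β)`. -/
def BC (α β : ℝ) (y : ℝ → ℝ) : Prop :=
  Y2 y 0 + α * y 0 - β * Y1 y 0 = 0 ∧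
  -β * Y3 y 0 + α * Y2 y 0 = 0 ∧
  Y2 y 1 + α * y 1 + β * Y1 y 1 = 0 ∧
  -β * Y3 y 1 - α * Y2 y 1 = 0

/-- `y` is an eigenfunction of the problem `(α, β)` with eigenvalue `lam`. -/
def Eigenfunction (P : ℝ → ℝ) (α β lam : ℝ) (y : ℝ → ℝ) : Prop :=
  Nontrivial01 y ∧ SolutionOn P lam y ∧ BC α β y

/-- `lam` is an eigenvalue of the problem `(α, β)`. -/
def IsEigenvalue (P : ℝ → ℝ) (α β lam : ℝ) : Prop :=
  ∃ y : ℝ → ℝ, Eigenfunction P α β lam y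

/-- The number `b = (1 - κ a)/(κ - 1)`. -/
noncomputable def bb (κ : ℕ) (a : ℝ) : ℝ := (1 - κ * a) / (κ - 1)

/-- `P` is a nondecreasing continuous function on `[0,1]` with `P 0 = 0`, `P 1 = 1`,
self-similar of Cantor type with parameters `κ ≥ 2` and `0 < a < 1/κ`. -/
def CantorSelfSimilar (P : ℝ → ℝ) (κ : ℕ) (a : ℝ) : Prop :=
  ContinuousOn P (Set.Icc 0 1) ∧ MonotoneOn P (Set.Icc 0 1) ∧
  P 0 = 0 ∧ P 1 = 1 ∧ 2 ≤ κ ∧ 0 < a ∧ a < 1 / κ ∧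
  (∀ k : ℕ, k < κ → ∃ c : ℝ, ∀ x ∈ Set.Icc (0:ℝ) 1,
      (κ : ℝ) * P (k * (a + bb κ a) + a * x) = P x + c) ∧
  (∀ k : ℕ, 1 ≤ k → k < κ →
      ∀ x ∈ Set.Ioo ((k:ℝ) * (a + bb κ a) - bb κ a) ((k:ℝ) * (a + bb κ a)),
      ∀ x' ∈ Set.Ioo ((k:ℝ) * (a + bb κ a) - bb κ a) ((k:ℝ) * (a + bb κ a)),
      P x = P x')

/-- Every bounded sequence has a subsequence along which the functionals `b (v n)` form a Cauchy
sequence in the dual norm. -/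
def FormCompact {V : Type*} [NormedAddCommGroup V] [NormedSpace ℝ V] (b : V →L[ℝ] V →L[ℝ] ℝ) :
    Prop :=
  ∀ v : ℕ → V, (∃ R, ∀ n, ‖v n‖ ≤ R) → ∃ φ : ℕ → ℕ, StrictMono φ ∧
    ∀ ε > 0, ∃ N, ∀ m ≥ N, ∀ n ≥ N, ∀ z, |b (v (φ m) - v (φ n)) z| ≤ ε * ‖z‖

/-- Cauchy–Schwarz for a symmetric form that is nonnegative on a submodule. -/
lemma sq_le_mul_of_nonneg_on {V : Type*} [NormedAddCommGroup V] [NormedSpace ℝ V]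
    (q : V →L[ℝ] V →L[ℝ] ℝ) (hq : ∀ u v, q u v = q v u) (U : Submodule ℝ V)
    (hU : ∀ v ∈ U, 0 ≤ q v v) {u z : V} (hu : u ∈ U) (hz : z ∈ U) :
    q u z ^ 2 ≤ q u u * q z z := by
  have h : ∀ s : ℝ, 0 ≤ q z z * (s * s) + 2 * q u z * s + q u u := by
    intro s
    have h1 := hU (u + s • z) (U.add_mem hu (U.smul_mem s hz))
    simp only [map_add, map_smul, add_apply, smul_apply,
      smul_eq_mul] at h1
    rw [hq z u] at h1
    linarith
  have h2 := discrim_le_zero h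
  unfold discrim at h2
  nlinarith

lemma exists_maximizer {V : Type*} [NormedAddCommGroup V] [NormedSpace ℝ V] [CompleteSpace V]
    (a b : V →L[ℝ] V →L[ℝ] ℝ) (ha : ∀ u v, a u v = a v u) (hb : ∀ u v, b u v = b v u)
    {c : ℝ} (hc : 0 < c) (hac : ∀ v, c * ‖v‖ ^ 2 ≤ a v v) (hcpt : FormCompact b)
    (U : Submodule ℝ V) (hU : IsClosed (U : Set V)) {t : ℝ} (ht : 0 < t)
    {v₀ : V} (hv₀ : v₀ ∈ U) (hne : v₀ ≠ 0) (hle : t * a v₀ v₀ ≤ b v₀ v₀) :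
    ∃ τ, t ≤ τ ∧ ∃ u ∈ U, u ≠ 0 ∧ ∀ z ∈ U, b u z = τ * a u z := by
  have hapos : ∀ v, v ≠ 0 → 0 < a v v := fun v hv =>
    lt_of_lt_of_le (by have := norm_pos_iff.2 hv; positivity) (hac v)
  have hnormalize : ∀ v, v ≠ 0 → ∃ r : ℝ, r ≠ 0 ∧ r ^ 2 * a v v = 1 := by
    intro v hv
    have h := hapos v hv
    refine ⟨(Real.sqrt (a v v))⁻¹, by positivity, ?_⟩
    rw [inv_pow, Real.sq_sqrt h.le]
    field_simp
  let S : Set ℝ := {r | ∃ v ∈ U, a v v = 1 ∧ b v v = r}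
  have hbdd : BddAbove S := by
    refine ⟨‖b‖ / c, ?_⟩
    rintro r ⟨v, -, hv1, rfl⟩
    have h1 : b v v ≤ ‖b‖ * ‖v‖ * ‖v‖ := (le_abs_self _).trans (b.le_opNorm₂ v v)
    have h2 := hac v
    rw [hv1] at h2
    rw [le_div_iff₀ hc]
    have := mul_le_mul_of_nonneg_left h2 (norm_nonneg b)
    nlinarith
  have hmem : ∀ v ∈ U, ∀ r : ℝ, r ^ 2 * a v v = 1 → r ^ 2 * b v v ∈ S := by
    intro v hv r hr
    refine ⟨r • v, U.smul_mem r hv, ?_, ?_⟩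
    · simp only [map_smul, smul_apply, smul_eq_mul]; linarith
    · simp only [map_smul, smul_apply, smul_eq_mul]; ring
  set τ := sSup S with hτ
  have htτ : t ≤ τ := by
    obtain ⟨r, hr0, hr⟩ := hnormalize v₀ hne
    refine le_trans ?_ (le_csSup hbdd (hmem v₀ hv₀ r hr))
    have := mul_le_mul_of_nonneg_left hle (sq_nonneg r)
    nlinarith
  have hτpos : 0 < τ := lt_of_lt_of_le ht htτ
  let q : V →L[ℝ] V →L[ℝ] ℝ := τ • a - b
  have hqe : ∀ u v, q u v = τ * a u v - b u v := fun u v => by simp [q]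
  have hqs : ∀ u v, q u v = q v u := fun u v => by rw [hqe, hqe, ha, hb]
  have hqU : ∀ v ∈ U, 0 ≤ q v v := by
    intro v hv
    rw [hqe]
    by_cases h0 : v = 0
    · simp [h0]
    obtain ⟨r, hr0, hr⟩ := hnormalize v h0
    have h1 := le_csSup hbdd (hmem v hv r hr)
    have h2 : 0 < r ^ 2 := by positivity
    have h3 : r ^ 2 * b v v ≤ r ^ 2 * (τ * a v v) := by
      calc _ ≤ τ := h1
        _ = τ * (r ^ 2 * a v v) := by rw [hr, mul_one]
        _ = _ := by ring
    linarith [le_of_mul_le_mul_left h3 h2]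
  have hne' : S.Nonempty := by
    obtain ⟨r, hr0, hr⟩ := hnormalize v₀ hne
    exact ⟨_, hmem v₀ hv₀ r hr⟩
  have hex : ∀ n : ℕ, ∃ v ∈ U, a v v = 1 ∧ q v v ≤ 1 / ((n : ℝ) + 1) := by
    intro n
    obtain ⟨r, ⟨v, hv, hv1, rfl⟩, hlt⟩ := exists_lt_of_lt_csSup hne'
      (show τ - 1 / ((n : ℝ) + 1) < τ by have : (0 : ℝ) < 1 / ((n : ℝ) + 1) := by positivity
                                         linarith)
    exact ⟨v, hv, hv1, by rw [hqe, hv1]; linarith⟩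
  choose v hvU hva hvq using hex
  have hvb : ∀ n, ‖v n‖ ≤ Real.sqrt (1 / c) := by
    intro n
    apply Real.le_sqrt_of_sq_le
    rw [le_div_iff₀ hc]
    linarith [hac (v n), hva n]
  obtain ⟨φ, hφ, hcau⟩ := hcpt v ⟨_, hvb⟩
  set δ : ℕ → ℝ := fun n => Real.sqrt (1 / ((n : ℝ) + 1) * ‖q‖) with hδ
  have hδ0 : Tendsto δ atTop (nhds 0) := by
    have h1 : Tendsto (fun n : ℕ => 1 / ((n : ℝ) + 1) * ‖q‖) atTop (nhds (0 * ‖q‖)) :=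
      tendsto_one_div_add_atTop_nhds_zero_nat.mul_const _
    have := (Real.continuous_sqrt.tendsto _).comp h1
    rwa [zero_mul, Real.sqrt_zero] at this
  have hqz : ∀ n, ∀ z ∈ U, |q (v n) z| ≤ δ n * ‖z‖ := by
    intro n z hz
    apply abs_le_of_sq_le_sq _ (by positivity)
    have h1 := sq_le_mul_of_nonneg_on q hqs U hqU (hvU n) hz
    have h2 : q z z ≤ ‖q‖ * ‖z‖ * ‖z‖ := (le_abs_self _).trans (q.le_opNorm₂ z z)
    rw [mul_pow, Real.sq_sqrt (by positivity)]
    calc _ ≤ _ := h1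
      _ ≤ 1 / ((n : ℝ) + 1) * (‖q‖ * ‖z‖ * ‖z‖) :=
        mul_le_mul (hvq n) h2 (hqU z hz) (by positivity)
      _ = _ := by ring
  have hcauchy : CauchySeq (fun n => v (φ n)) := by
    rw [Metric.cauchySeq_iff]
    intro ε hε
    have hη : 0 < τ * c * ε / 4 := by positivity
    obtain ⟨N₁, hN₁⟩ := hcau _ hη
    obtain ⟨N₂, hN₂⟩ := eventually_atTop.1 (hδ0.eventually (gt_mem_nhds hη))
    refine ⟨max N₁ N₂, fun m hm n hn => ?_⟩
    rw [dist_eq_norm]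
    set d := v (φ m) - v (φ n) with hd
    have hdU : d ∈ U := U.sub_mem (hvU _) (hvU _)
    have h1 := (abs_le.1 (hqz (φ m) d hdU)).2
    have h2 := (abs_le.1 (hqz (φ n) d hdU)).1
    have h3 := (abs_le.1 (hN₁ m (le_trans (le_max_left _ _) hm) n
      (le_trans (le_max_left _ _) hn) d)).2
    have h4 := hN₂ (φ m) ((le_trans (le_max_right _ _) hm).trans (hφ.id_le m))
    have h5 := hN₂ (φ n) ((le_trans (le_max_right _ _) hn).trans (hφ.id_le n))
    have h6 : q d d = q (v (φ m)) d - q (v (φ n)) d := by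
      rw [← sub_apply, ← map_sub]
    have h7 := hqe d d
    have h8 := mul_le_mul_of_nonneg_left (hac d) hτpos.le
    have h9 : τ * c * ‖d‖ ^ 2 ≤ (τ * c * ε * 3 / 4) * ‖d‖ := by
      have e1 := mul_le_mul_of_nonneg_right h4.le (norm_nonneg d)
      have e2 := mul_le_mul_of_nonneg_right h5.le (norm_nonneg d)
      change b d d ≤ _ at h3
      nlinarith
    by_contra hcon
    push Not at hcon
    have hdpos : 0 < ‖d‖ := lt_of_lt_of_le hε hcon
    have : τ * c * ‖d‖ * ‖d‖ ≤ (τ * c * ε * 3 / 4) * ‖d‖ := by nlinarith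
    have := le_of_mul_le_mul_right this hdpos
    have hτc : 0 < τ * c := by positivity
    nlinarith
  obtain ⟨u, hu⟩ := cauchySeq_tendsto_of_complete hcauchy
  have huU : u ∈ U := hU.mem_of_tendsto hu (Eventually.of_forall fun n => hvU _)
  have hcont : ∀ p : V →L[ℝ] V →L[ℝ] ℝ, Tendsto (fun n => p (v (φ n)) (v (φ n))) atTop
      (nhds (p u u)) := by
    intro p
    have : Continuous fun x => p x x := by fun_prop
    exact (this.tendsto u).comp hu
  have hau : a u u = 1 := by
    refine tendsto_nhds_unique (hcont a) ?_
    simp [hva]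
  have hqu : q u u = 0 := by
    refine le_antisymm ?_ (hqU u huU)
    refine le_of_tendsto_of_tendsto (hcont q)
      (tendsto_one_div_add_atTop_nhds_zero_nat.comp hφ.tendsto_atTop)
      (Eventually.of_forall fun n => hvq _)
  refine ⟨τ, htτ, u, huU, ?_, ?_⟩
  · rintro rfl; simp at hau
  · intro z hz
    have h1 := sq_le_mul_of_nonneg_on q hqs U hqU huU hz
    rw [hqu, zero_mul] at h1
    have h2 : q u z = 0 := pow_eq_zero_iff two_ne_zero |>.1 (le_antisymm h1 (sq_nonneg _))
    rw [hqe] at h2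
    linarith

/-- The generalized eigenvalue set of the pencil `Q - lam b`. -/
def pencilEigenvalues {V : Type*} [NormedAddCommGroup V] [NormedSpace ℝ V]
    (Q b : V →L[ℝ] V →L[ℝ] ℝ) : Set ℝ :=
  {lam | ∃ v, v ≠ 0 ∧ ∀ z, Q v z = lam * b v z}

lemma pencilEigenvalues_finite {V : Type*} [NormedAddCommGroup V] [NormedSpace ℝ V]
    (Q b : V →L[ℝ] V →L[ℝ] ℝ) (hb : ∀ u v, b u v = b v u) (hQ : ∀ u v, Q u v = Q v u)
    (hb0 : ∀ v, 0 ≤ b v v)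
    {c : ℝ} (hc : 0 < c) (hac : ∀ v, c * ‖v‖ ^ 2 ≤ Q v v + b v v) (hcpt : FormCompact b)
    {L : ℝ} (hL : 0 < L) : {lam | lam ∈ pencilEigenvalues Q b ∧ lam ≤ L}.Finite := by
  by_contra hinf
  have hinf' : Set.Infinite {lam | lam ∈ pencilEigenvalues Q b ∧ lam ≤ L} := hinf
  let f := hinf'.natEmbedding
  have hex : ∀ n : ℕ, ∃ v : V, Q v v + b v v = 1 ∧ ∀ z, Q v z = (f n : ℝ) * b v z := by
    intro n
    obtain ⟨⟨v, hv0, hv⟩, -⟩ := (f n).2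
    have hpos : 0 < Q v v + b v v :=
      lt_of_lt_of_le (by have := norm_pos_iff.2 hv0; positivity) (hac v)
    refine ⟨(Real.sqrt (Q v v + b v v))⁻¹ • v, ?_, fun z => ?_⟩
    · simp only [map_smul, smul_apply, smul_eq_mul]
      have h := Real.sq_sqrt hpos.le
      have hs : 0 < Real.sqrt (Q v v + b v v) := Real.sqrt_pos.2 hpos
      set s := Real.sqrt (Q v v + b v v)
      field_simp
      linarith
    · simp only [map_smul, smul_apply, smul_eq_mul]
      rw [hv z]; ring
  choose v hv1 hv using hex
  have hvb : ∀ n, ‖v n‖ ≤ Real.sqrt (1 / c) := by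
    intro n
    apply Real.le_sqrt_of_sq_le
    rw [le_div_iff₀ hc]
    linarith [hac (v n), hv1 n]
  have hlow : ∀ n, 1 / (L + 1) ≤ b (v n) (v n) := by
    intro n
    have h1 := hv1 n
    rw [hv n] at h1
    have h2 : (f n : ℝ) ≤ L := (f n).2.2
    rw [div_le_iff₀ (by linarith)]
    nlinarith [hb0 (v n)]
  have horth : ∀ m n, m ≠ n → b (v m) (v n) = 0 := by
    intro m n hmn
    have h1 := hv m (v n)
    have h2 := hv n (v m)
    rw [hQ, h2, hb (v n) (v m)] at h1
    have h3 : (f n : ℝ) ≠ f m := fun h => hmn (f.injective (Subtype.ext h)).symm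
    have h4 : ((f n : ℝ) - f m) * b (v m) (v n) = 0 := by linarith
    exact (mul_eq_zero.1 h4).resolve_left (sub_ne_zero.2 h3)
  obtain ⟨φ, hφ, hcau⟩ := hcpt v ⟨_, hvb⟩
  set s := Real.sqrt (1 / c) with hs
  have hs0 : 0 < s := Real.sqrt_pos.2 (by positivity)
  obtain ⟨N, hN⟩ := hcau (1 / (L + 1) / (2 * s)) (by positivity)
  have h1 := (abs_le.1 (hN N le_rfl (N + 1) (Nat.le_succ N) (v (φ N)))).2
  rw [map_sub, sub_apply,
    horth (φ (N + 1)) (φ N) (hφ (Nat.lt_succ_self N)).ne', sub_zero] at h1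
  have h2 : 1 / (L + 1) / (2 * s) * ‖v (φ N)‖ ≤ 1 / (L + 1) / (2 * s) * s :=
    mul_le_mul_of_nonneg_left (hvb _) (by positivity)
  have h3 : 1 / (L + 1) / (2 * s) * s = 1 / (L + 1) / 2 := by field_simp
  have h4 := hlow (φ N)
  have h5 : 0 < 1 / (L + 1) := by positivity
  linarith

lemma pencil_ncard_le {V : Type*} [NormedAddCommGroup V] [NormedSpace ℝ V] [CompleteSpace V]
    (Q₁ Q₂ b : V →L[ℝ] V →L[ℝ] ℝ) (hb : ∀ u v, b u v = b v u) (hQ₁ : ∀ u v, Q₁ u v = Q₁ v u)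
    (hQ₂ : ∀ u v, Q₂ u v = Q₂ v u) (hb0 : ∀ v, 0 ≤ b v v)
    {c₁ : ℝ} (hc₁ : 0 < c₁) (hac₁ : ∀ v, c₁ * ‖v‖ ^ 2 ≤ Q₁ v v + b v v)
    {c₂ : ℝ} (hc₂ : 0 < c₂) (hac₂ : ∀ v, c₂ * ‖v‖ ^ 2 ≤ Q₂ v v + b v v)
    (hcpt : FormCompact b) {d : ℕ} (F : V →ₗ[ℝ] (Fin d → ℝ))
    (hF : ∀ v, F v = 0 → Q₂ v v = Q₁ v v) (l : V →ₗ[ℝ] ℝ)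
    (hsimple : ∀ lam, ∀ v, (∀ z, Q₂ v z = lam * b v z) → l v = 0 → v = 0)
    {L : ℝ} (hL : 0 < L) :
    {lam | lam ∈ pencilEigenvalues Q₁ b ∧ lam ≤ L}.ncard ≤
      {lam | lam ∈ pencilEigenvalues Q₂ b ∧ lam ≤ L}.ncard + d := by
  have hfin₁ := pencilEigenvalues_finite Q₁ b hb hQ₁ hb0 hc₁ hac₁ hcpt hL
  have hfin₂ := pencilEigenvalues_finite Q₂ b hb hQ₂ hb0 hc₂ hac₂ hcpt hL
  set E₁ := {lam | lam ∈ pencilEigenvalues Q₁ b ∧ lam ≤ L} with hE₁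
  set E₂ := {lam | lam ∈ pencilEigenvalues Q₂ b ∧ lam ≤ L} with hE₂
  have := hfin₁.fintype
  have := hfin₂.fintype
  by_contra hcon
  push Not at hcon
  have hx₁ : ∀ μ : E₁, ∃ v : V, v ≠ 0 ∧ ∀ z, Q₁ v z = (μ : ℝ) * b v z := fun μ => μ.2.1
  have hx₂ : ∀ μ : E₂, ∃ v : V, v ≠ 0 ∧ ∀ z, Q₂ v z = (μ : ℝ) * b v z := fun μ => μ.2.1
  choose v hv0 hv using hx₁
  choose e he0 he using hx₂
  let a : V →L[ℝ] V →L[ℝ] ℝ := Q₂ + b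
  have hae : ∀ u z, a u z = Q₂ u z + b u z := fun u z => by simp [a]
  have has : ∀ u z, a u z = a z u := fun u z => by rw [hae, hae, hQ₂, hb]
  let Φ : (E₁ → ℝ) →ₗ[ℝ] V := Fintype.linearCombination ℝ v
  let A : V →ₗ[ℝ] (E₂ → ℝ) := LinearMap.pi fun k => (a (e k)).toLinearMap
  let G : (E₁ → ℝ) →ₗ[ℝ] (E₂ → ℝ) × (Fin d → ℝ) := (A.prod F).comp Φ
  have hker : LinearMap.ker G ≠ ⊥ := by
    apply LinearMap.ker_ne_bot_of_finrank_lt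
    rw [Module.finrank_prod, Module.finrank_fintype_fun_eq_card, Module.finrank_fintype_fun_eq_card,
      Module.finrank_fintype_fun_eq_card, Fintype.card_fin]
    rw [← Nat.card_eq_fintype_card, ← Nat.card_eq_fintype_card]
    exact hcon
  obtain ⟨x, hxk, hx0⟩ := (Submodule.ne_bot_iff _).1 hker
  have hΦ : Φ x = ∑ i, x i • v i := rfl
  have hGx : A (Φ x) = 0 ∧ F (Φ x) = 0 := by
    have : G x = 0 := hxk
    exact ⟨congrArg Prod.fst this, congrArg Prod.snd this⟩
  have hbpos : ∀ i, 0 < b (v i) (v i) := by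
    intro i
    have h1 : 0 < Q₁ (v i) (v i) + b (v i) (v i) :=
      lt_of_lt_of_le (by have := norm_pos_iff.2 (hv0 i); positivity) (hac₁ (v i))
    refine lt_of_le_of_ne (hb0 _) fun h => ?_
    rw [hv i, ← h] at h1
    simp at h1
  have horth : ∀ i j, i ≠ j → b (v i) (v j) = 0 := by
    intro m n hmn
    have h1 := hv m (v n)
    have h2 := hv n (v m)
    rw [hQ₁, h2, hb (v n) (v m)] at h1
    have h3 : (n : ℝ) ≠ m := fun h => hmn (Subtype.ext h).symm
    have h4 : ((n : ℝ) - m) * b (v m) (v n) = 0 := by linarith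
    exact (mul_eq_zero.1 h4).resolve_left (sub_ne_zero.2 h3)
  have hbv : ∀ i, b (v i) (Φ x) = x i * b (v i) (v i) := by
    intro i
    rw [hΦ, map_sum, Finset.sum_eq_single i]
    · simp
    · intro j _ hj; simp [horth i j hj.symm]
    · simp
  have hbx : b (Φ x) (Φ x) = ∑ i, x i ^ 2 * b (v i) (v i) := by
    conv_lhs => rw [show b (Φ x) = ∑ i, x i • b (v i) by rw [hΦ, map_sum]; simp]
    rw [sum_apply]
    refine Finset.sum_congr rfl fun i _ => ?_
    rw [smul_apply, hbv, smul_eq_mul]; ring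
  have hQx : Q₁ (Φ x) (Φ x) = ∑ i : E₁, (i : ℝ) * (x i ^ 2 * b (v i) (v i)) := by
    conv_lhs => rw [show Q₁ (Φ x) = ∑ i, x i • Q₁ (v i) by rw [hΦ, map_sum]; simp]
    rw [sum_apply]
    refine Finset.sum_congr rfl fun i _ => ?_
    rw [smul_apply, hv, hbv, smul_eq_mul]; ring
  have hΦ0 : Φ x ≠ 0 := by
    intro h0
    rw [h0] at hbx
    simp only [map_zero] at hbx
    have h1 := (Finset.sum_eq_zero_iff_of_nonneg
      (fun i _ => mul_nonneg (sq_nonneg (x i)) (hb0 (v i)))).1 hbx.symm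
    apply hx0
    funext i
    have h2 := (mul_eq_zero.1 (h1 i (Finset.mem_univ i))).resolve_right (hbpos i).ne'
    simpa using h2
  have hQle : Q₁ (Φ x) (Φ x) ≤ L * b (Φ x) (Φ x) := by
    rw [hQx, hbx, Finset.mul_sum]
    exact Finset.sum_le_sum fun i _ =>
      mul_le_mul_of_nonneg_right i.2.2 (mul_nonneg (sq_nonneg _) (hb0 _))
  let U : Submodule ℝ V := ⨅ k, LinearMap.ker (a (e k)).toLinearMap
  have hmemU : ∀ u, u ∈ U ↔ ∀ k, a (e k) u = 0 := by
    intro u; simp [U, Submodule.mem_iInf]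
  have hUc : IsClosed (U : Set V) := by
    have : (U : Set V) = ⋂ k, {u | a (e k) u = 0} := by
      ext u; simp [hmemU]
    rw [this]
    exact isClosed_iInter fun k => isClosed_eq (by fun_prop) continuous_const
  have hΦU : Φ x ∈ U := (hmemU _).2 fun k => congrFun hGx.1 k
  obtain ⟨τ, hτ, u, huU, hu0, hu⟩ := exists_maximizer a b has hb hc₂
    (fun v => by rw [hae]; exact hac₂ v) hcpt U hUc (t := 1 / (L + 1)) (by positivity) hΦU hΦ0
    (by rw [hae, hF _ hGx.2, div_mul_eq_mul_div, div_le_iff₀ (by linarith)]; linarith)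
  have hτpos : 0 < τ := lt_of_lt_of_le (by positivity) hτ
  have haee : ∀ k, 0 < a (e k) (e k) := fun k => by
    rw [hae]
    exact lt_of_lt_of_le (by have := norm_pos_iff.2 (he0 k); positivity) (hac₂ (e k))
  have haeb : ∀ k z, a (e k) z = ((k : ℝ) + 1) * b (e k) z := fun k z => by
    rw [hae, he]; ring
  have hk1 : ∀ k : E₂, (k : ℝ) + 1 ≠ 0 := fun k h => by
    have := haee k
    rw [haeb, h, zero_mul] at this
    exact lt_irrefl _ this
  have hbe : ∀ k, b u (e k) = 0 := fun k => by
    have h1 := (hmemU u).1 huU k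
    rw [haeb] at h1
    rw [hb]
    exact (mul_eq_zero.1 h1).resolve_left (hk1 k)
  have horthe : ∀ i j, i ≠ j → a (e i) (e j) = 0 := by
    intro m n hmn
    have h1 := he m (e n)
    have h2 := he n (e m)
    rw [hQ₂, h2, hb (e n) (e m)] at h1
    have h3 : (n : ℝ) ≠ m := fun h => hmn (Subtype.ext h).symm
    have h4 : ((n : ℝ) - m) * b (e m) (e n) = 0 := by linarith
    rw [haeb, (mul_eq_zero.1 h4).resolve_left (sub_ne_zero.2 h3), mul_zero]
  have hall : ∀ z, b u z = τ * a u z := by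
    intro z
    set p := ∑ k, (a (e k) z / a (e k) (e k)) • e k with hp
    have hzU : z - p ∈ U := by
      refine (hmemU _).2 fun k => ?_
      rw [map_sub, hp, map_sum, Finset.sum_eq_single k]
      · rw [map_smul, smul_eq_mul, div_mul_cancel₀ _ (haee k).ne', sub_self]
      · intro j _ hj; simp [horthe k j hj.symm]
      · simp
    have h1 := hu _ hzU
    have h2 : b u p = 0 := by
      rw [hp, map_sum]
      exact Finset.sum_eq_zero fun k _ => by rw [map_smul, hbe, smul_zero]
    have h3 : a u p = 0 := by
      rw [hp, map_sum]
      exact Finset.sum_eq_zero fun k _ => by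
        rw [map_smul, has u, (hmemU u).1 huU k, smul_zero]
    rw [map_sub, map_sub, h2, h3] at h1
    linarith
  have hweak : ∀ z, Q₂ u z = (1 / τ - 1) * b u z := by
    intro z
    have h1 := hall z
    rw [hae] at h1
    field_simp
    linarith
  have hτL : 1 / τ - 1 ≤ L := by
    have : 1 / τ ≤ L + 1 := by
      rw [div_le_iff₀ hτpos]
      rw [div_le_iff₀ (by linarith)] at hτ
      linarith
    linarith
  let k₀ : E₂ := ⟨1 / τ - 1, ⟨u, hu0, hweak⟩, hτL⟩
  have hle : l (e k₀) ≠ 0 := fun h => he0 k₀ (hsimple _ _ (he k₀) h)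
  have hz : u - (l u / l (e k₀)) • e k₀ = 0 := by
    apply hsimple (1 / τ - 1)
    · intro z
      have h1 := he k₀ z
      simp only [map_sub, map_smul, sub_apply, smul_apply,
        smul_eq_mul, hweak z, h1, k₀]
      ring
    · simp [hle]
  have h1 : a u u = 0 := by
    calc a u u = a u ((l u / l (e k₀)) • e k₀) := by rw [← sub_eq_zero.1 hz]
      _ = 0 := by rw [map_smul, has u, (hmemU u).1 huU k₀, smul_zero]
  rw [hae] at h1
  have := hac₂ u
  have : 0 < c₂ * ‖u‖ ^ 2 := by have := norm_pos_iff.2 hu0; positivity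
  linarith

/-- The Hilbert space `L²(0,1)`. -/
noncomputable abbrev UnitL2 := MeasureTheory.Lp ℝ 2 (MeasureTheory.volume.restrict (Ioc (0:ℝ) 1))

/-- The space `H²(0,1)`, a function `y` being encoded by `(y 0, y' 0, y'')`. -/
noncomputable abbrev EnergySpace := ℝ × ℝ × UnitL2

/-- Extension by zero of an `L²` function to the real line. -/
noncomputable def zeroExt (g : UnitL2) : ℝ → ℝ := (Ioc (0:ℝ) 1).indicator g

lemma zeroExt_integrable (g : UnitL2) : MeasureTheory.Integrable (zeroExt g) := by
  unfold zeroExt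
  rw [MeasureTheory.integrable_indicator_iff measurableSet_Ioc]
  exact (MeasureTheory.Lp.memLp g).integrable (by norm_num)

lemma zeroExt_ae_eq {g : UnitL2} {f : ℝ → ℝ}
    (h : g =ᵐ[MeasureTheory.volume.restrict (Ioc (0:ℝ) 1)] f) :
    zeroExt g =ᵐ[MeasureTheory.volume] (Ioc (0:ℝ) 1).indicator f := by
  rw [Filter.EventuallyEq, MeasureTheory.ae_restrict_iff' measurableSet_Ioc] at h
  filter_upwards [h] with x hx
  by_cases hm : x ∈ Ioc (0:ℝ) 1
  · simp [zeroExt, hm, hx hm]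
  · simp [zeroExt, hm]

lemma zeroExt_add (g h : UnitL2) :
    zeroExt (g + h) =ᵐ[MeasureTheory.volume] zeroExt g + zeroExt h := by
  refine (zeroExt_ae_eq (MeasureTheory.Lp.coeFn_add g h)).trans ?_
  rw [indicator_add']; rfl

lemma zeroExt_smul (r : ℝ) (g : UnitL2) :
    zeroExt (r • g) =ᵐ[MeasureTheory.volume] r • zeroExt g := by
  refine (zeroExt_ae_eq (MeasureTheory.Lp.coeFn_smul r g)).trans ?_
  refine Eventually.of_forall fun x => ?_
  by_cases hm : x ∈ Ioc (0:ℝ) 1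
  · simp [zeroExt, hm]
  · simp [zeroExt, hm]

lemma inner_eq_integral_zeroExt (g h : UnitL2) :
    inner ℝ g h = ∫ x in (0:ℝ)..1, zeroExt g x * zeroExt h x := by
  rw [MeasureTheory.L2.inner_def, intervalIntegral.integral_of_le zero_le_one]
  refine MeasureTheory.setIntegral_congr_fun measurableSet_Ioc fun x hx => ?_
  simp [zeroExt, hx, mul_comm]

lemma abs_integral_zeroExt_le (g : UnitL2) {x y : ℝ} (hxy : x ≤ y) :
    |∫ t in x..y, zeroExt g t| ≤ Real.sqrt (y - x) * ‖g‖ := by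
  have hfin : (MeasureTheory.volume.restrict (Ioc (0:ℝ) 1)) (Ioc x y) ≠ ⊤ :=
    MeasureTheory.measure_ne_top _ _
  have h1 := MeasureTheory.L2.inner_indicatorConstLp_one (𝕜 := ℝ) measurableSet_Ioc hfin g
  have h2 : ∫ t in x..y, zeroExt g t =
      ∫ t in Ioc x y, g t ∂(MeasureTheory.volume.restrict (Ioc (0:ℝ) 1)) := by
    rw [intervalIntegral.integral_of_le hxy]
    unfold zeroExt
    rw [MeasureTheory.setIntegral_indicator measurableSet_Ioc,
      MeasureTheory.Measure.restrict_restrict measurableSet_Ioc]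
  rw [h2, ← h1]
  refine (abs_real_inner_le_norm _ _).trans ?_
  refine mul_le_mul_of_nonneg_right ?_ (norm_nonneg g)
  rw [MeasureTheory.norm_indicatorConstLp (by norm_num) (by norm_num)]
  simp only [norm_one, one_mul, ENNReal.toReal_ofNat]
  rw [Real.sqrt_eq_rpow]
  refine Real.rpow_le_rpow (by positivity) ?_ (by norm_num)
  rw [MeasureTheory.measureReal_restrict_apply measurableSet_Ioc]
  calc _ ≤ MeasureTheory.volume.real (Ioc x y) :=
        MeasureTheory.measureReal_mono inter_subset_left measure_Ioc_lt_top.ne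
    _ = y - x := by rw [Real.volume_real_Ioc_of_le hxy]

/-- The first derivative of the function encoded by `v`. -/
noncomputable def slopeFn (v : EnergySpace) (x : ℝ) : ℝ := v.2.1 + ∫ t in (0:ℝ)..x, zeroExt v.2.2 t

/-- The function encoded by `v`. -/
noncomputable def deflFn (v : EnergySpace) (x : ℝ) : ℝ := v.1 + ∫ t in (0:ℝ)..x, slopeFn v t

lemma slopeFn_continuous (v : EnergySpace) : Continuous (slopeFn v) := by
  unfold slopeFn
  exact continuous_const.add ((zeroExt_integrable v.2.2).continuous_primitive 0)

lemma deflFn_hasDerivAt (v : EnergySpace) (x : ℝ) : HasDerivAt (deflFn v) (slopeFn v x) x :=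
  ((slopeFn_continuous v).integral_hasStrictDerivAt 0 x).hasDerivAt.const_add _

lemma deflFn_continuous (v : EnergySpace) : Continuous (deflFn v) :=
  continuous_iff_continuousAt.2 fun x => (deflFn_hasDerivAt v x).continuousAt

lemma slopeFn_zero (v : EnergySpace) : slopeFn v 0 = v.2.1 := by simp [slopeFn]

lemma deflFn_zero (v : EnergySpace) : deflFn v 0 = v.1 := by simp [deflFn]

lemma slopeFn_add (u v : EnergySpace) (x : ℝ) : slopeFn (u + v) x = slopeFn u x + slopeFn v x := by
  unfold slopeFn
  rw [show (u + v).2.2 = u.2.2 + v.2.2 from rfl, show (u + v).2.1 = u.2.1 + v.2.1 from rfl,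
    intervalIntegral.integral_congr_ae ((zeroExt_add u.2.2 v.2.2).mono fun t ht _ => ht)]
  simp only [Pi.add_apply]
  rw [intervalIntegral.integral_add (zeroExt_integrable _).intervalIntegrable
    (zeroExt_integrable _).intervalIntegrable]
  ring

lemma slopeFn_smul (r : ℝ) (v : EnergySpace) (x : ℝ) : slopeFn (r • v) x = r * slopeFn v x := by
  unfold slopeFn
  rw [show (r • v).2.2 = r • v.2.2 from rfl, show (r • v).2.1 = r * v.2.1 from rfl,
    intervalIntegral.integral_congr_ae ((zeroExt_smul r v.2.2).mono fun t ht _ => ht)]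
  simp only [Pi.smul_apply, smul_eq_mul]
  rw [intervalIntegral.integral_const_mul]
  ring

lemma deflFn_add (u v : EnergySpace) (x : ℝ) : deflFn (u + v) x = deflFn u x + deflFn v x := by
  unfold deflFn
  simp only [slopeFn_add, Prod.fst_add]
  rw [intervalIntegral.integral_add ((slopeFn_continuous _).intervalIntegrable _ _)
    ((slopeFn_continuous _).intervalIntegrable _ _)]
  ring

lemma deflFn_smul (r : ℝ) (v : EnergySpace) (x : ℝ) : deflFn (r • v) x = r * deflFn v x := by
  unfold deflFn
  simp only [slopeFn_smul, Prod.smul_fst, smul_eq_mul]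
  rw [intervalIntegral.integral_const_mul]
  ring

lemma abs_sub_slopeFn_le (v : EnergySpace) {x y : ℝ} (hxy : x ≤ y) :
    |slopeFn v y - slopeFn v x| ≤ Real.sqrt (y - x) * ‖v‖ := by
  have h1 : slopeFn v y - slopeFn v x = ∫ t in x..y, zeroExt v.2.2 t := by
    unfold slopeFn
    rw [add_sub_add_left_eq_sub, intervalIntegral.integral_interval_sub_left
      (zeroExt_integrable _).intervalIntegrable (zeroExt_integrable _).intervalIntegrable]
  rw [h1]
  exact (abs_integral_zeroExt_le _ hxy).trans (mul_le_mul_of_nonneg_left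
    ((norm_snd_le v.2).trans (norm_snd_le v)) (Real.sqrt_nonneg _))

lemma abs_slopeFn_le (v : EnergySpace) {x : ℝ} (hx : x ∈ Icc (0:ℝ) 1) :
    |slopeFn v x| ≤ 2 * ‖v‖ := by
  have h1 := abs_sub_slopeFn_le v hx.1
  rw [slopeFn_zero] at h1
  have h2 : Real.sqrt (x - 0) ≤ 1 :=
    (Real.sqrt_le_sqrt (by linarith [hx.2])).trans_eq Real.sqrt_one
  have h3 : |v.2.1| ≤ ‖v‖ := (norm_fst_le v.2).trans (norm_snd_le v)
  have h4 := abs_sub_abs_le_abs_sub (slopeFn v x) v.2.1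
  nlinarith [norm_nonneg v]

lemma abs_deflFn_le_of_slope {v : EnergySpace} {K x : ℝ} (hx : x ∈ Icc (0:ℝ) 1)
    (hK : ∀ t ∈ Icc (0:ℝ) 1, |slopeFn v t| ≤ K) : |deflFn v x| ≤ |v.1| + K := by
  have h1 : |∫ t in (0:ℝ)..x, slopeFn v t| ≤ K * |x - 0| := by
    rw [← Real.norm_eq_abs]
    refine intervalIntegral.norm_integral_le_of_norm_le_const fun t ht => hK t ?_
    rw [uIoc_of_le hx.1] at ht
    exact ⟨ht.1.le, ht.2.trans hx.2⟩
  have hK0 : 0 ≤ K := (abs_nonneg _).trans (hK x hx)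
  rw [sub_zero, abs_of_nonneg hx.1] at h1
  unfold deflFn
  refine (abs_add_le _ _).trans ?_
  nlinarith [hx.2]

lemma abs_deflFn_le (v : EnergySpace) {x : ℝ} (hx : x ∈ Icc (0:ℝ) 1) :
    |deflFn v x| ≤ 3 * ‖v‖ := by
  have h1 := abs_deflFn_le_of_slope hx (fun t ht => abs_slopeFn_le v ht)
  have h2 : |v.1| ≤ ‖v‖ := norm_fst_le v
  linarith

/-- Bound of the form of the mass distribution in terms of uniform norms. -/
lemma abs_mass_le {P : ℝ → ℝ} (hb : ∀ x, |P x| ≤ 1) {v : EnergySpace}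
    (z : EnergySpace) {K : ℝ} (hs : ∀ t ∈ Icc (0:ℝ) 1, |slopeFn v t| ≤ K)
    (hd : ∀ t ∈ Icc (0:ℝ) 1, |deflFn v t| ≤ K) :
    |deflFn v 1 * deflFn z 1 -
      ∫ x in (0:ℝ)..1, P x * (slopeFn v x * deflFn z x + deflFn v x * slopeFn z x)|
      ≤ 8 * K * ‖z‖ := by
  have h1m : (1:ℝ) ∈ Icc (0:ℝ) 1 := ⟨zero_le_one, le_rfl⟩
  have hK0 : 0 ≤ K := (abs_nonneg _).trans (hs 1 h1m)
  have h1 : |∫ x in (0:ℝ)..1, P x * (slopeFn v x * deflFn z x + deflFn v x * slopeFn z x)|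
      ≤ 5 * K * ‖z‖ * |(1:ℝ) - 0| := by
    rw [← Real.norm_eq_abs]
    refine intervalIntegral.norm_integral_le_of_norm_le_const fun t ht => ?_
    rw [uIoc_of_le zero_le_one] at ht
    have ht' : t ∈ Icc (0:ℝ) 1 := ⟨ht.1.le, ht.2⟩
    rw [Real.norm_eq_abs, abs_mul]
    have e1 : |slopeFn v t * deflFn z t| ≤ K * (3 * ‖z‖) := by
      rw [abs_mul]
      exact mul_le_mul (hs t ht') (abs_deflFn_le z ht') (abs_nonneg _) hK0
    have e2 : |deflFn v t * slopeFn z t| ≤ K * (2 * ‖z‖) := by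
      rw [abs_mul]
      exact mul_le_mul (hd t ht') (abs_slopeFn_le z ht') (abs_nonneg _) hK0
    have e3 := (abs_add_le (slopeFn v t * deflFn z t) (deflFn v t * slopeFn z t))
    calc _ ≤ 1 * |slopeFn v t * deflFn z t + deflFn v t * slopeFn z t| :=
          mul_le_mul_of_nonneg_right (hb t) (abs_nonneg _)
      _ ≤ _ := by linarith
  have h2 : |deflFn v 1 * deflFn z 1| ≤ K * (3 * ‖z‖) := by
    rw [abs_mul]
    exact mul_le_mul (hd 1 h1m) (abs_deflFn_le z h1m) (abs_nonneg _) hK0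
  have h3 := abs_sub (deflFn v 1 * deflFn z 1)
    (∫ x in (0:ℝ)..1, P x * (slopeFn v x * deflFn z x + deflFn v x * slopeFn z x))
  norm_num at h1
  linarith

/-- The form `∫ y z dP`, written by means of integration by parts. -/
noncomputable def massForm (P : ℝ → ℝ) (hc : Continuous P) (hb : ∀ x, |P x| ≤ 1) :
    EnergySpace →L[ℝ] EnergySpace →L[ℝ] ℝ :=
  (LinearMap.mk₂ ℝ (fun v z : EnergySpace => deflFn v 1 * deflFn z 1 -
    ∫ x in (0:ℝ)..1, P x * (slopeFn v x * deflFn z x + deflFn v x * slopeFn z x))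
    (by
      intro u v z
      simp only [deflFn_add, slopeFn_add]
      have hu := slopeFn_continuous u
      have hv := slopeFn_continuous v
      have hz := slopeFn_continuous z
      have hu' := deflFn_continuous u
      have hv' := deflFn_continuous v
      have hz' := deflFn_continuous z
      rw [show (fun x => P x * ((slopeFn u x + slopeFn v x) * deflFn z x +
        (deflFn u x + deflFn v x) * slopeFn z x)) = fun x =>
        P x * (slopeFn u x * deflFn z x + deflFn u x * slopeFn z x) +
        P x * (slopeFn v x * deflFn z x + deflFn v x * slopeFn z x) by funext x; ring]
      rw [intervalIntegral.integral_add (Continuous.intervalIntegrable (by fun_prop) _ _)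
        (Continuous.intervalIntegrable (by fun_prop) _ _)]
      ring)
    (by
      intro r v z
      simp only [deflFn_smul, slopeFn_smul]
      rw [show (fun x => P x * (r * slopeFn v x * deflFn z x + r * deflFn v x * slopeFn z x)) =
        fun x => r * (P x * (slopeFn v x * deflFn z x + deflFn v x * slopeFn z x)) by
          funext x; ring]
      rw [intervalIntegral.integral_const_mul, smul_eq_mul]
      ring)
    (by
      intro z u v
      simp only [deflFn_add, slopeFn_add]
      have hu := slopeFn_continuous u
      have hv := slopeFn_continuous v
      have hz := slopeFn_continuous z
      have hu' := deflFn_continuous u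
      have hv' := deflFn_continuous v
      have hz' := deflFn_continuous z
      rw [show (fun x => P x * (slopeFn z x * (deflFn u x + deflFn v x) +
        deflFn z x * (slopeFn u x + slopeFn v x))) = fun x =>
        P x * (slopeFn z x * deflFn u x + deflFn z x * slopeFn u x) +
        P x * (slopeFn z x * deflFn v x + deflFn z x * slopeFn v x) by funext x; ring]
      rw [intervalIntegral.integral_add (Continuous.intervalIntegrable (by fun_prop) _ _)
        (Continuous.intervalIntegrable (by fun_prop) _ _)]
      ring)
    (by
      intro r z v
      simp only [deflFn_smul, slopeFn_smul]
      rw [show (fun x => P x * (slopeFn z x * (r * deflFn v x) + deflFn z x * (r * slopeFn v x))) =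
        fun x => r * (P x * (slopeFn z x * deflFn v x + deflFn z x * slopeFn v x)) by
          funext x; ring]
      rw [intervalIntegral.integral_const_mul, smul_eq_mul]
      ring)).mkContinuous₂ 24 (by
      intro v z
      refine (abs_mass_le hb z (K := 3 * ‖v‖)
        (fun t ht => (abs_slopeFn_le v ht).trans (by linarith [norm_nonneg v]))
        (fun t ht => abs_deflFn_le v ht)).trans (by linarith))

lemma massForm_apply {P : ℝ → ℝ} (hc : Continuous P) (hb : ∀ x, |P x| ≤ 1) (v z : EnergySpace) :
    massForm P hc hb v z = deflFn v 1 * deflFn z 1 -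
      ∫ x in (0:ℝ)..1, P x * (slopeFn v x * deflFn z x + deflFn v x * slopeFn z x) := rfl

lemma massForm_symm {P : ℝ → ℝ} (hc : Continuous P) (hb : ∀ x, |P x| ≤ 1) (v z : EnergySpace) :
    massForm P hc hb v z = massForm P hc hb z v := by
  rw [massForm_apply, massForm_apply, mul_comm]
  congr 2
  funext x
  ring

/-- The boundary functional at `0`. -/
noncomputable def leftBdry (α β : ℝ) : EnergySpace →ₗ[ℝ] ℝ where
  toFun v := β * slopeFn v 0 - α * deflFn v 0
  map_add' u v := by rw [slopeFn_add, deflFn_add]; ring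
  map_smul' r v := by rw [slopeFn_smul, deflFn_smul, smul_eq_mul, RingHom.id_apply]; ring

/-- The boundary functional at `1`. -/
noncomputable def rightBdry (α β : ℝ) : EnergySpace →ₗ[ℝ] ℝ where
  toFun v := β * slopeFn v 1 + α * deflFn v 1
  map_add' u v := by rw [slopeFn_add, deflFn_add]; ring
  map_smul' r v := by rw [slopeFn_smul, deflFn_smul, smul_eq_mul, RingHom.id_apply]; ring

lemma leftBdry_apply (α β : ℝ) (v : EnergySpace) :
    leftBdry α β v = β * v.2.1 - α * v.1 := by
  change β * slopeFn v 0 - α * deflFn v 0 = _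
  rw [slopeFn_zero, deflFn_zero]

lemma rightBdry_apply (α β : ℝ) (v : EnergySpace) :
    rightBdry α β v = β * slopeFn v 1 + α * deflFn v 1 := rfl

lemma abs_leftBdry_le (α β : ℝ) (v : EnergySpace) :
    |leftBdry α β v| ≤ (2 * |β| + 3 * |α|) * ‖v‖ := by
  have h0 : (0:ℝ) ∈ Icc (0:ℝ) 1 := ⟨le_rfl, zero_le_one⟩
  refine (abs_sub _ _).trans ?_
  rw [abs_mul, abs_mul]
  nlinarith [mul_le_mul_of_nonneg_left (abs_slopeFn_le v h0) (abs_nonneg β),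
    mul_le_mul_of_nonneg_left (abs_deflFn_le v h0) (abs_nonneg α)]

lemma abs_rightBdry_le (α β : ℝ) (v : EnergySpace) :
    |rightBdry α β v| ≤ (2 * |β| + 3 * |α|) * ‖v‖ := by
  have h0 : (1:ℝ) ∈ Icc (0:ℝ) 1 := ⟨zero_le_one, le_rfl⟩
  refine (abs_add_le _ _).trans ?_
  rw [abs_mul, abs_mul]
  nlinarith [mul_le_mul_of_nonneg_left (abs_slopeFn_le v h0) (abs_nonneg β),
    mul_le_mul_of_nonneg_left (abs_deflFn_le v h0) (abs_nonneg α)]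

/-- The energy form of the problem `(α, β)`. -/
noncomputable def energyForm (α β : ℝ) : EnergySpace →L[ℝ] EnergySpace →L[ℝ] ℝ :=
  (LinearMap.mk₂ ℝ (fun v z : EnergySpace => inner ℝ v.2.2 z.2.2 +
      β⁻¹ * (leftBdry α β v * leftBdry α β z + rightBdry α β v * rightBdry α β z))
    (by intro u v z; simp only [Prod.snd_add, inner_add_left, map_add]; ring)
    (by intro r v z
        simp only [Prod.smul_snd, real_inner_smul_left, map_smul, smul_eq_mul]; ring)
    (by intro u v z; simp only [Prod.snd_add, inner_add_right, map_add]; ring)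
    (by intro r v z
        simp only [Prod.smul_snd, real_inner_smul_right, map_smul, smul_eq_mul]; ring)).mkContinuous₂
    (1 + |β⁻¹| * (2 * (2 * |β| + 3 * |α|) ^ 2)) (by
      intro v z
      have h1 : |inner ℝ v.2.2 z.2.2| ≤ ‖v‖ * ‖z‖ :=
        (abs_real_inner_le_norm _ _).trans (mul_le_mul ((norm_snd_le v.2).trans (norm_snd_le v))
          ((norm_snd_le z.2).trans (norm_snd_le z)) (norm_nonneg _) (norm_nonneg _))
      set K := 2 * |β| + 3 * |α| with hK
      have hK0 : 0 ≤ K := by positivity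
      have h2 : |leftBdry α β v * leftBdry α β z| ≤ (K * ‖v‖) * (K * ‖z‖) := by
        rw [abs_mul]
        exact mul_le_mul (abs_leftBdry_le _ _ _) (abs_leftBdry_le _ _ _) (abs_nonneg _)
          (by positivity)
      have h3 : |rightBdry α β v * rightBdry α β z| ≤ (K * ‖v‖) * (K * ‖z‖) := by
        rw [abs_mul]
        exact mul_le_mul (abs_rightBdry_le _ _ _) (abs_rightBdry_le _ _ _) (abs_nonneg _)
          (by positivity)
      rw [LinearMap.mk₂_apply, Real.norm_eq_abs]
      refine (abs_add_le _ _).trans ?_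
      rw [abs_mul]
      have h4 := mul_le_mul_of_nonneg_left
        ((abs_add_le (leftBdry α β v * leftBdry α β z) (rightBdry α β v * rightBdry α β z)).trans
          (add_le_add h2 h3)) (abs_nonneg β⁻¹)
      linarith)

lemma energyForm_apply (α β : ℝ) (v z : EnergySpace) :
    energyForm α β v z = inner ℝ v.2.2 z.2.2 +
      β⁻¹ * (leftBdry α β v * leftBdry α β z + rightBdry α β v * rightBdry α β z) := rfl

lemma energyForm_symm (α β : ℝ) (v z : EnergySpace) :
    energyForm α β v z = energyForm α β z v := by
  rw [energyForm_apply, energyForm_apply, real_inner_comm]; ring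

lemma energyForm_nonneg (α : ℝ) {β : ℝ} (hβ : 0 < β) (v : EnergySpace) :
    0 ≤ energyForm α β v v := by
  rw [energyForm_apply]
  have h1 : 0 ≤ inner ℝ v.2.2 v.2.2 := real_inner_self_nonneg
  have h2 := mul_self_nonneg (leftBdry α β v)
  have h3 := mul_self_nonneg (rightBdry α β v)
  positivity

lemma integral_monotone_mul_deriv_le {P f f' : ℝ → ℝ} (hc : Continuous P) (hm : Monotone P)
    (hf' : Continuous f') (hd : ∀ x, HasDerivAt f (f' x) x) (hf : ∀ x, 0 ≤ f x) {M x y : ℝ}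
    (hxy : x ≤ y) (hM : ∀ t ∈ Icc x y, |f' t| ≤ M) :
    ∫ t in x..y, P t * f' t ≤ P y * f y - P x * f x + M * (y - x) * (P y - P x) := by
  have h1 : ∫ t in x..y, f' t = f y - f x :=
    intervalIntegral.integral_eq_sub_of_hasDerivAt (fun t _ => hd t) (hf'.intervalIntegrable _ _)
  have h2 : ∫ t in x..y, (P y - P t) * f' t = P y * (f y - f x) - ∫ t in x..y, P t * f' t := by
    rw [← h1, ← intervalIntegral.integral_const_mul, ← intervalIntegral.integral_sub
      (Continuous.intervalIntegrable (by fun_prop) _ _)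
      (Continuous.intervalIntegrable (by fun_prop) _ _)]
    congr 1
    funext t
    ring
  have hM0 : 0 ≤ M := (abs_nonneg _).trans (hM x ⟨le_rfl, hxy⟩)
  have h3 : ‖∫ t in x..y, (P y - P t) * f' t‖ ≤ (P y - P x) * M * |y - x| := by
    refine intervalIntegral.norm_integral_le_of_norm_le_const fun t ht => ?_
    rw [uIoc_of_le hxy] at ht
    have hPt : P x ≤ P t := hm ht.1.le
    have hPt' : P t ≤ P y := hm ht.2
    rw [Real.norm_eq_abs, abs_mul, abs_of_nonneg (sub_nonneg.2 hPt')]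
    exact mul_le_mul (by linarith) (hM t ⟨ht.1.le, ht.2⟩) (abs_nonneg _) (by linarith)
  rw [Real.norm_eq_abs, h2, abs_of_nonneg (sub_nonneg.2 hxy)] at h3
  have h4 := (abs_le.1 h3).1
  have h5 := mul_le_mul_of_nonneg_right (hm hxy) (hf x)
  nlinarith

lemma integral_monotone_mul_deriv_le_sub {P f f' : ℝ → ℝ} (hc : Continuous P) (hm : Monotone P)
    (hf' : Continuous f') (hd : ∀ x, HasDerivAt f (f' x) x) (hf : ∀ x, 0 ≤ f x) :
    ∫ t in (0:ℝ)..1, P t * f' t ≤ P 1 * f 1 - P 0 * f 0 := by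
  obtain ⟨M, hM⟩ := isCompact_Icc.exists_bound_of_continuousOn
    (s := Icc (0:ℝ) 1) hf'.continuousOn
  have key : ∀ n : ℕ, ∫ t in (0:ℝ)..1, P t * f' t ≤
      P 1 * f 1 - P 0 * f 0 + M * (P 1 - P 0) * (1 / ((n:ℝ) + 1)) := by
    intro n
    have hn : (0:ℝ) < (n:ℝ) + 1 := by positivity
    have h1 := intervalIntegral.sum_integral_adjacent_intervals (n := n + 1)
      (μ := MeasureTheory.volume)
      (f := fun t => P t * f' t) (a := fun k : ℕ => (k:ℝ) / ((n:ℝ) + 1))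
      (fun k _ => Continuous.intervalIntegrable (by fun_prop) _ _)
    simp only [Nat.cast_zero, zero_div, Nat.cast_add, Nat.cast_one, div_self hn.ne'] at h1
    rw [← h1]
    have h2 := Finset.sum_range_sub (fun k : ℕ => P ((k:ℝ) / ((n:ℝ) + 1)) * f ((k:ℝ) / ((n:ℝ) + 1))
      + M * (1 / ((n:ℝ) + 1)) * P ((k:ℝ) / ((n:ℝ) + 1))) (n + 1)
    simp only [Nat.cast_zero, zero_div, Nat.cast_add, Nat.cast_one, div_self hn.ne'] at h2
    refine (Finset.sum_le_sum fun k hk => ?_).trans (h2.le.trans (by linarith))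
    have hk' : (k:ℝ) + 1 ≤ (n:ℝ) + 1 := by
      have := Finset.mem_range.1 hk
      exact_mod_cast this
    have h3 := integral_monotone_mul_deriv_le hc hm hf' hd hf (M := M)
      (x := (k:ℝ) / ((n:ℝ) + 1)) (y := ((k:ℝ) + 1) / ((n:ℝ) + 1))
      (by gcongr; linarith) (fun t ht => hM t ⟨le_trans (by positivity) ht.1,
        ht.2.trans ((div_le_one hn).2 hk')⟩)
    rw [show ((k:ℝ) + 1) / ((n:ℝ) + 1) - (k:ℝ) / ((n:ℝ) + 1) = 1 / ((n:ℝ) + 1) by ring] at h3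
    linarith
  have hlim : Tendsto (fun n : ℕ => P 1 * f 1 - P 0 * f 0 + M * (P 1 - P 0) * (1 / ((n:ℝ) + 1)))
      atTop (nhds (P 1 * f 1 - P 0 * f 0 + M * (P 1 - P 0) * 0)) :=
    (tendsto_one_div_add_atTop_nhds_zero_nat.const_mul _).const_add _
  have := ge_of_tendsto' hlim key
  linarith

lemma massForm_nonneg {P : ℝ → ℝ} (hc : Continuous P) (hb : ∀ x, |P x| ≤ 1) (hm : Monotone P)
    (h0 : P 0 = 0) (h1 : P 1 = 1) (v : EnergySpace) : 0 ≤ massForm P hc hb v v := by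
  have h := integral_monotone_mul_deriv_le_sub hc hm (f := fun x => deflFn v x * deflFn v x)
    (f' := fun x => slopeFn v x * deflFn v x + deflFn v x * slopeFn v x)
    (by have := slopeFn_continuous v; have := deflFn_continuous v; fun_prop)
    (fun x => (deflFn_hasDerivAt v x).mul (deflFn_hasDerivAt v x)) (fun x => mul_self_nonneg _)
  rw [massForm_apply]
  rw [h0, h1] at h
  linarith

lemma abs_massForm_le {P : ℝ → ℝ} (hc : Continuous P) (hb : ∀ x, |P x| ≤ 1) (v z : EnergySpace) :
    |massForm P hc hb v z| ≤ 24 * ‖v‖ * ‖z‖ :=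
  (abs_mass_le hb z (K := 3 * ‖v‖)
    (fun t ht => (abs_slopeFn_le v ht).trans (by linarith [norm_nonneg v]))
    (fun t ht => abs_deflFn_le v ht)).trans (by linarith)

lemma slopeFn_sub (u v : EnergySpace) (x : ℝ) : slopeFn (u - v) x = slopeFn u x - slopeFn v x := by
  rw [sub_eq_add_neg, ← neg_one_smul ℝ, slopeFn_add, slopeFn_smul]; ring

/-- Bounded sequences have subsequences along which slopes converge uniformly. -/
lemma exists_subseq_slopeFn_cauchy {v : ℕ → EnergySpace} {R : ℝ} (hR : ∀ n, ‖v n‖ ≤ R) :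
    ∃ φ : ℕ → ℕ, StrictMono φ ∧ ∀ ε > 0, ∃ N, ∀ m ≥ N, ∀ n ≥ N, ∀ t ∈ Icc (0:ℝ) 1,
      |slopeFn (v (φ m)) t - slopeFn (v (φ n)) t| ≤ ε := by
  have hR0 : 0 ≤ R := (norm_nonneg _).trans (hR 0)
  let F : ℕ → BoundedContinuousFunction (Icc (0:ℝ) 1) ℝ := fun n =>
    BoundedContinuousFunction.mkOfCompact
      ⟨fun t => slopeFn (v n) t, (slopeFn_continuous _).comp continuous_subtype_val⟩
  have hF : ∀ n t, F n t = slopeFn (v n) t := fun n t => rfl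
  have hcpt : IsCompact (closure (range F)) := by
    refine BoundedContinuousFunction.arzela_ascoli (Icc (-(2 * R)) (2 * R)) isCompact_Icc
      (range F) ?_ ?_
    · rintro _ x ⟨n, rfl⟩
      rw [hF]
      have h := abs_slopeFn_le (v n) x.2
      exact abs_le.1 (h.trans (by linarith [hR n]))
    · refine Metric.equicontinuous_of_continuity_modulus
        (fun d => Real.sqrt d * R) ?_ _ ?_
      · have : Continuous fun d => Real.sqrt d * R := by fun_prop
        simpa using this.tendsto 0
      · rintro x y ⟨_, n, rfl⟩
        have key : ∀ a b : ℝ, a ≤ b →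
            |slopeFn (v n) b - slopeFn (v n) a| ≤ Real.sqrt |a - b| * R := by
          intro a b hab
          rw [abs_sub_comm a b, abs_of_nonneg (sub_nonneg.2 hab)]
          exact (abs_sub_slopeFn_le (v n) hab).trans
            (mul_le_mul_of_nonneg_left (hR n) (Real.sqrt_nonneg _))
        change dist (slopeFn (v n) x) (slopeFn (v n) y) ≤ Real.sqrt (dist (x:ℝ) (y:ℝ)) * R
        rcases le_total (x:ℝ) y with h | h
        · rw [Real.dist_eq, Real.dist_eq, abs_sub_comm]
          exact key _ _ h
        · rw [Real.dist_eq, Real.dist_eq, abs_sub_comm (x:ℝ)]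
          exact key _ _ h
  obtain ⟨g, -, φ, hφ, hlim⟩ := hcpt.tendsto_subseq (fun n => subset_closure (mem_range_self n))
  refine ⟨φ, hφ, fun ε hε => ?_⟩
  obtain ⟨N, hN⟩ := Metric.cauchySeq_iff.1 hlim.cauchySeq ε hε
  refine ⟨N, fun m hm n hn t ht => ?_⟩
  have := BoundedContinuousFunction.dist_coe_le_dist (f := F (φ m)) (g := F (φ n)) ⟨t, ht⟩
  exact this.trans (hN m hm n hn).le

lemma massForm_formCompact {P : ℝ → ℝ} (hc : Continuous P) (hb : ∀ x, |P x| ≤ 1) :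
    FormCompact (massForm P hc hb) := by
  rintro v ⟨R, hR⟩
  obtain ⟨φ, hφ, hslope⟩ := exists_subseq_slopeFn_cauchy hR
  obtain ⟨c, -, ψ, hψ, hlim⟩ := (isCompact_Icc (a := -R) (b := R)).tendsto_subseq
    (x := fun n => (v (φ n)).1) (fun n => abs_le.1 ((norm_fst_le _).trans (hR _)))
  refine ⟨φ ∘ ψ, hφ.comp hψ, fun ε hε => ?_⟩
  obtain ⟨N₁, hN₁⟩ := hslope (ε / 16) (by positivity)
  obtain ⟨N₂, hN₂⟩ := Metric.cauchySeq_iff.1 hlim.cauchySeq (ε / 16) (by positivity)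
  refine ⟨max N₁ N₂, fun m hm n hn z => ?_⟩
  have hs : ∀ t ∈ Icc (0:ℝ) 1,
      |slopeFn (v ((φ ∘ ψ) m) - v ((φ ∘ ψ) n)) t| ≤ ε / 16 := by
    intro t ht
    rw [slopeFn_sub]
    exact hN₁ _ (((le_max_left _ _).trans hm).trans hψ.le_apply) _
      (((le_max_left _ _).trans hn).trans hψ.le_apply) t ht
  have hd : |(v ((φ ∘ ψ) m) - v ((φ ∘ ψ) n)).1| ≤ ε / 16 :=
    (hN₂ m ((le_max_right _ _).trans hm) n ((le_max_right _ _).trans hn)).le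
  refine (abs_mass_le hb z (K := ε / 8) (fun t ht => (hs t ht).trans (by linarith))
    (fun t ht => (abs_deflFn_le_of_slope ht hs).trans (by linarith))).trans_eq (by ring)

lemma sq_add_le_of_nonneg_form {V : Type*} [NormedAddCommGroup V] [NormedSpace ℝ V]
    {b : V →L[ℝ] V →L[ℝ] ℝ} (hsymm : ∀ v z, b v z = b z v) (hb0 : ∀ v, 0 ≤ b v v) (u w : V) :
    b (u - w) (u - w) ≤ 2 * b u u + 2 * b w w := by
  have h := hb0 (u + w)
  simp only [map_add, map_sub, add_apply, sub_apply] at h ⊢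
  have := hsymm u w
  linarith

set_option maxHeartbeats 800000 in
lemma energyForm_coercive {P : ℝ → ℝ} (hc : Continuous P) (hb : ∀ x, |P x| ≤ 1)
    (hm : Monotone P) (h0 : P 0 = 0) (h1 : P 1 = 1) {α β : ℝ} (hα : 0 ≤ α) (hβ : 0 < β) :
    ∃ c : ℝ, 0 < c ∧ ∀ v, c * ‖v‖ ^ 2 ≤ energyForm α β v v + massForm P hc hb v v := by
  set q := 2 * β + α with hq
  have hq0 : 0 < q := by positivity
  set D := 4 * (2 * β + β ^ 2 + α ^ 2) / q ^ 2 with hD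
  have hD0 : 0 < D := by positivity
  set E := 2 + 48 * (D + 1) with hE
  have hE0 : 0 < E := by positivity
  refine ⟨(1 + D + E)⁻¹, by positivity, fun v => ?_⟩
  set S := energyForm α β v v + massForm P hc hb v v with hS
  have hm0 := massForm_nonneg hc hb hm h0 h1 v
  have hen := energyForm_apply α β v v
  rw [real_inner_self_eq_norm_sq] at hen
  have he1 := mul_self_nonneg (leftBdry α β v)
  have he2 := mul_self_nonneg (rightBdry α β v)
  have hbi : 0 < β⁻¹ := by positivity
  have hg : ‖v.2.2‖ ^ 2 ≤ S := by
    have := mul_nonneg hbi.le (add_nonneg he1 he2)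
    linarith
  have hS0 : 0 ≤ S := (sq_nonneg _).trans hg
  have hee : leftBdry α β v * leftBdry α β v + rightBdry α β v * rightBdry α β v ≤ β * S := by
    have : β⁻¹ * (leftBdry α β v * leftBdry α β v + rightBdry α β v * rightBdry α β v) ≤ S := by
      nlinarith [sq_nonneg ‖v.2.2‖]
    calc _ = β * (β⁻¹ * (leftBdry α β v * leftBdry α β v +
          rightBdry α β v * rightBdry α β v)) := by field_simp
      _ ≤ _ := by gcongr
  have hd : v.2.1 ^ 2 ≤ D * S := by
    let w : EnergySpace := (0, 0, v.2.2)
    have hw : ‖w‖ = ‖v.2.2‖ := by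
      change max ‖(0:ℝ)‖ (max ‖(0:ℝ)‖ ‖v.2.2‖) = _
      simp
    have hvs : ∀ t, slopeFn v t = v.2.1 + slopeFn w t := fun t => by simp [slopeFn, w]
    have hvd : deflFn v 1 = v.1 + v.2.1 + deflFn w 1 := by
      simp only [deflFn, hvs, w]
      rw [intervalIntegral.integral_add (by simp)
        ((slopeFn_continuous _).intervalIntegrable _ _)]
      simp
      ring
    have hws : ∀ t ∈ Icc (0:ℝ) 1, |slopeFn w t| ≤ ‖v.2.2‖ := by
      intro t ht
      have := abs_sub_slopeFn_le w ht.1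
      rw [slopeFn_zero, sub_zero, sub_zero, hw] at this
      refine this.trans (mul_le_of_le_one_left (norm_nonneg _) ?_)
      exact (Real.sqrt_le_sqrt ht.2).trans_eq Real.sqrt_one
    have h1m : (1:ℝ) ∈ Icc (0:ℝ) 1 := ⟨zero_le_one, le_rfl⟩
    have hs := sq_le_sq' (abs_le.1 (hws 1 h1m)).1 (abs_le.1 (hws 1 h1m)).2
    have hr' := abs_le.1 (abs_deflFn_le_of_slope h1m hws)
    simp only [w, abs_zero, zero_add] at hr'
    have hr := sq_le_sq' hr'.1 hr'.2
    have hsum : q * v.2.1 = leftBdry α β v + rightBdry α β v - β * slopeFn w 1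
        - α * deflFn w 1 := by
      rw [leftBdry_apply, rightBdry_apply, hvs, hvd]; ring
    have hsq : q ^ 2 * v.2.1 ^ 2 ≤ 4 * ((leftBdry α β v) ^ 2 + (rightBdry α β v) ^ 2
        + (β * slopeFn w 1) ^ 2 + (α * deflFn w 1) ^ 2) := by
      rw [← mul_pow, hsum]
      nlinarith [sq_nonneg (leftBdry α β v - rightBdry α β v),
        sq_nonneg (leftBdry α β v + β * slopeFn w 1), sq_nonneg (leftBdry α β v + α * deflFn w 1),
        sq_nonneg (rightBdry α β v + β * slopeFn w 1),
        sq_nonneg (rightBdry α β v + α * deflFn w 1),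
        sq_nonneg (β * slopeFn w 1 - α * deflFn w 1)]
    have hs2 : (β * slopeFn w 1) ^ 2 ≤ β ^ 2 * S := by
      rw [mul_pow]; exact mul_le_mul_of_nonneg_left (hs.trans hg) (sq_nonneg _)
    have hr2 : (α * deflFn w 1) ^ 2 ≤ α ^ 2 * S := by
      rw [mul_pow]; exact mul_le_mul_of_nonneg_left (hr.trans hg) (sq_nonneg _)
    rw [hD, div_mul_eq_mul_div, le_div_iff₀ (by positivity)]
    nlinarith [mul_nonneg hβ.le hS0]
  have hcq : v.1 ^ 2 ≤ E * S := by
    let w : EnergySpace := (0, v.2)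
    have hw : ‖w‖ ^ 2 ≤ v.2.1 ^ 2 + ‖v.2.2‖ ^ 2 := by
      change (max ‖(0:ℝ)‖ (max ‖v.2.1‖ ‖v.2.2‖)) ^ 2 ≤ _
      rw [norm_zero, max_eq_right (by positivity)]
      rcases max_choice ‖v.2.1‖ ‖v.2.2‖ with h | h <;> rw [h]
      · rw [Real.norm_eq_abs, sq_abs]; linarith [sq_nonneg ‖v.2.2‖]
      · linarith [sq_nonneg v.2.1]
    have hvw : v - w = (v.1, 0, 0) := by
      ext1
      · exact sub_zero _
      · exact sub_self _
    have hz : ∀ g : EnergySpace, g = 0 → ∀ x, slopeFn g x = 0 := by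
      rintro _ rfl x
      rw [← zero_smul ℝ (0 : EnergySpace), slopeFn_smul, zero_mul]
    have hslope : ∀ x, slopeFn (v.1, 0, 0) x = 0 := fun x => hz (0, 0, 0) rfl x
    have hmass : massForm P hc hb (v - w) (v - w) = v.1 ^ 2 := by
      rw [hvw, massForm_apply]
      simp [hslope, deflFn, sq]
    have h2 := sq_add_le_of_nonneg_form (massForm_symm hc hb)
      (massForm_nonneg hc hb hm h0 h1) v w
    rw [hmass] at h2
    have h3 := (le_abs_self _).trans (abs_massForm_le hc hb w w)
    have h4 : massForm P hc hb v v ≤ S := by linarith [energyForm_nonneg α hβ v]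
    have h5 : 24 * ‖w‖ * ‖w‖ = 24 * ‖w‖ ^ 2 := by ring
    have h6 : E * S = 2 * S + 48 * (D * S + S) := by rw [hE]; ring
    rw [h6]
    linarith
  have hv : ‖v‖ ^ 2 ≤ v.1 ^ 2 + v.2.1 ^ 2 + ‖v.2.2‖ ^ 2 := by
    change (max ‖v.1‖ (max ‖v.2.1‖ ‖v.2.2‖)) ^ 2 ≤ _
    rcases max_choice ‖v.1‖ (max ‖v.2.1‖ ‖v.2.2‖) with h | h <;> rw [h]
    · rw [Real.norm_eq_abs, sq_abs]; linarith [sq_nonneg ‖v.2.2‖, sq_nonneg v.2.1]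
    · rcases max_choice ‖v.2.1‖ ‖v.2.2‖ with h | h <;> rw [h]
      · rw [Real.norm_eq_abs, sq_abs]; linarith [sq_nonneg ‖v.2.2‖, sq_nonneg v.1]
      · linarith [sq_nonneg v.2.1, sq_nonneg v.1]
  rw [inv_mul_le_iff₀ (by positivity), add_mul, add_mul, one_mul]
  linarith

/-- Integration by parts against the first derivative of an element of the energy space. -/
lemma integral_mul_slopeFn {W w : ℝ → ℝ} (hW : ∀ x, HasDerivAt W (w x) x) (hw : Continuous w)
    (z : EnergySpace) :
    ∫ x in (0:ℝ)..1, w x * slopeFn z x =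
      W 1 * slopeFn z 1 - W 0 * slopeFn z 0 - ∫ x in (0:ℝ)..1, W x * zeroExt z.2.2 x := by
  have hh : IntervalIntegrable (zeroExt z.2.2) MeasureTheory.volume 0 1 :=
    (zeroExt_integrable z.2.2).intervalIntegrable
  have hW1 : AbsolutelyContinuousOnInterval W 0 1 := by
    refine ContDiffOn.absolutelyContinuousOnInterval (ContDiff.contDiffOn ?_)
    rw [contDiff_one_iff_deriv]
    refine ⟨fun x => (hW x).differentiableAt, ?_⟩
    rwa [show deriv W = w from funext fun x => (hW x).deriv]
  have hH : AbsolutelyContinuousOnInterval (fun x => ∫ t in (0:ℝ)..x, zeroExt z.2.2 t) 0 1 :=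
    hh.absolutelyContinuousOnInterval_intervalIntegral left_mem_uIcc
  have h1 := hW1.integral_mul_deriv_eq_deriv_mul hH
  have h2 : ∫ x in (0:ℝ)..1, W x * deriv (fun x => ∫ t in (0:ℝ)..x, zeroExt z.2.2 t) x =
      ∫ x in (0:ℝ)..1, W x * zeroExt z.2.2 x := by
    refine intervalIntegral.integral_congr_ae ?_
    filter_upwards [hh.ae_hasDerivAt_integral] with x hx hxm
    rw [(hx (uIoc_subset_uIcc hxm) 0 left_mem_uIcc).deriv]
  rw [h2] at h1
  simp only [(hW _).deriv, intervalIntegral.integral_same, mul_zero, sub_zero] at h1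
  have h3 : ∫ x in (0:ℝ)..1, w x = W 1 - W 0 :=
    intervalIntegral.integral_eq_sub_of_hasDerivAt (fun t _ => hW t) (hw.intervalIntegrable _ _)
  have h4 : ∫ x in (0:ℝ)..1, w x * slopeFn z x = (∫ x in (0:ℝ)..1, w x) * z.2.1 +
      ∫ x in (0:ℝ)..1, w x * ∫ t in (0:ℝ)..x, zeroExt z.2.2 t := by
    have hcont : Continuous fun x => ∫ t in (0:ℝ)..x, zeroExt z.2.2 t :=
      (zeroExt_integrable z.2.2).continuous_primitive 0
    have hi : IntervalIntegrable (fun x => w x * ∫ t in (0:ℝ)..x, zeroExt z.2.2 t)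
      MeasureTheory.volume 0 1 := (hw.mul hcont).intervalIntegrable _ _
    have hi' : IntervalIntegrable (fun x => w x * z.2.1) MeasureTheory.volume 0 1 :=
      (hw.mul continuous_const).intervalIntegrable _ _
    rw [← intervalIntegral.integral_mul_const, ← intervalIntegral.integral_add hi' hi]
    congr 1
    funext x
    rw [slopeFn]
    ring
  rw [h4, h3, h1, slopeFn_zero, slopeFn]
  ring

lemma deflFn_one (z : EnergySpace) :
    deflFn z 1 = z.1 + z.2.1 + ∫ x in (0:ℝ)..1, (1 - x) * zeroExt z.2.2 x := by
  have h := integral_mul_slopeFn (W := fun x => x - 1) (w := fun _ => 1)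
    (fun x => (hasDerivAt_id x).sub_const 1) continuous_const z
  simp only [one_mul, sub_self, zero_mul, zero_sub, slopeFn_zero] at h
  rw [deflFn, h]
  have h2 : ∫ x in (0:ℝ)..1, (x - 1) * zeroExt z.2.2 x =
      - ∫ x in (0:ℝ)..1, (1 - x) * zeroExt z.2.2 x := by
    rw [← intervalIntegral.integral_neg]
    congr 1
    funext x
    ring
  rw [h2]
  ring

lemma slopeFn_one (z : EnergySpace) :
    slopeFn z 1 = z.2.1 + ∫ x in (0:ℝ)..1, zeroExt z.2.2 x := rfl

/-- The first primitive of the load `P' y`, where `y` is the function encoded by `v`. -/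
noncomputable def loadFn (P : ℝ → ℝ) (v : EnergySpace) (x : ℝ) : ℝ :=
  P x * deflFn v x - ∫ t in (0:ℝ)..x, P t * slopeFn v t

/-- The second primitive of the load `P' y`. -/
noncomputable def loadPrim (P : ℝ → ℝ) (v : EnergySpace) (x : ℝ) : ℝ :=
  ∫ t in (0:ℝ)..x, loadFn P v t

lemma hasDerivAt_integral_slopeFn {P : ℝ → ℝ} (hc : Continuous P) (v : EnergySpace) (x : ℝ) :
    HasDerivAt (fun x => ∫ t in (0:ℝ)..x, P t * slopeFn v t) (P x * slopeFn v x) x :=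
  ((hc.mul (slopeFn_continuous v)).integral_hasStrictDerivAt 0 x).hasDerivAt

lemma loadFn_continuous {P : ℝ → ℝ} (hc : Continuous P) (v : EnergySpace) :
    Continuous (loadFn P v) :=
  (hc.mul (deflFn_continuous v)).sub
    (continuous_iff_continuousAt.2 fun x => (hasDerivAt_integral_slopeFn hc v x).continuousAt)

lemma loadPrim_hasDerivAt {P : ℝ → ℝ} (hc : Continuous P) (v : EnergySpace) (x : ℝ) :
    HasDerivAt (loadPrim P v) (loadFn P v x) x :=
  ((loadFn_continuous hc v).integral_hasStrictDerivAt 0 x).hasDerivAt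

lemma loadPrim_continuous {P : ℝ → ℝ} (hc : Continuous P) (v : EnergySpace) :
    Continuous (loadPrim P v) :=
  continuous_iff_continuousAt.2 fun x => (loadPrim_hasDerivAt hc v x).continuousAt

lemma loadPrim_zero (P : ℝ → ℝ) (v : EnergySpace) : loadPrim P v 0 = 0 := by simp [loadPrim]

lemma loadFn_zero {P : ℝ → ℝ} (h0 : P 0 = 0) (v : EnergySpace) : loadFn P v 0 = 0 := by
  simp [loadFn, h0]

lemma massForm_eq_load {P : ℝ → ℝ} (hc : Continuous P) (hb : ∀ x, |P x| ≤ 1) (h1 : P 1 = 1)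
    (v z : EnergySpace) :
    massForm P hc hb v z = loadFn P v 1 * deflFn z 1 - loadPrim P v 1 * slopeFn z 1 +
      ∫ x in (0:ℝ)..1, loadPrim P v x * zeroExt z.2.2 x := by
  have hv := slopeFn_continuous v
  have hz := slopeFn_continuous z
  have hv' := deflFn_continuous v
  have hz' := deflFn_continuous z
  have hF : Continuous fun x => ∫ t in (0:ℝ)..x, P t * slopeFn v t :=
    continuous_iff_continuousAt.2 fun x => (hasDerivAt_integral_slopeFn hc v x).continuousAt
  have e1 := integral_mul_slopeFn (loadPrim_hasDerivAt hc v) (loadFn_continuous hc v) z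
  have e2 := intervalIntegral.integral_mul_deriv_eq_deriv_mul (a := 0) (b := 1)
    (fun x _ => deflFn_hasDerivAt z x) (fun x _ => hasDerivAt_integral_slopeFn hc v x)
    (hz.intervalIntegrable _ _) (Continuous.intervalIntegrable (by fun_prop) _ _)
  have e3 : ∫ x in (0:ℝ)..1, loadFn P v x * slopeFn z x =
      (∫ x in (0:ℝ)..1, P x * deflFn v x * slopeFn z x) -
      ∫ x in (0:ℝ)..1, slopeFn z x * ∫ t in (0:ℝ)..x, P t * slopeFn v t := by
    have hi : IntervalIntegrable (fun x => slopeFn z x * ∫ t in (0:ℝ)..x, P t * slopeFn v t)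
      MeasureTheory.volume 0 1 := (hz.mul hF).intervalIntegrable _ _
    have hi' : IntervalIntegrable (fun x => P x * deflFn v x * slopeFn z x)
      MeasureTheory.volume 0 1 := Continuous.intervalIntegrable (by fun_prop) _ _
    rw [← intervalIntegral.integral_sub hi' hi]
    congr 1
    funext x
    rw [loadFn]
    ring
  have e4 : ∫ x in (0:ℝ)..1, P x * (slopeFn v x * deflFn z x + deflFn v x * slopeFn z x) =
      (∫ x in (0:ℝ)..1, deflFn z x * (P x * slopeFn v x)) +
      ∫ x in (0:ℝ)..1, P x * deflFn v x * slopeFn z x := by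
    rw [← intervalIntegral.integral_add (Continuous.intervalIntegrable (by fun_prop) _ _)
      (Continuous.intervalIntegrable (by fun_prop) _ _)]
    congr 1
    funext x
    ring
  rw [loadPrim_zero] at e1
  rw [massForm_apply, e4, e2]
  simp only [intervalIntegral.integral_same]
  have e5 : loadFn P v 1 = deflFn v 1 - ∫ t in (0:ℝ)..1, P t * slopeFn v t := by
    rw [loadFn, h1, one_mul]
  rw [e5]
  linarith

/-- A continuous function as an element of `L²(0,1)`. -/
lemma continuous_memLp {G : ℝ → ℝ} (hG : Continuous G) :
    MeasureTheory.MemLp G 2 (MeasureTheory.volume.restrict (Ioc (0:ℝ) 1)) := by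
  obtain ⟨M, hM⟩ := isCompact_Icc.exists_bound_of_continuousOn
    (s := Icc (0:ℝ) 1) hG.continuousOn
  refine MeasureTheory.MemLp.of_bound hG.aestronglyMeasurable M ?_
  rw [MeasureTheory.ae_restrict_iff' measurableSet_Ioc]
  exact Eventually.of_forall fun x hx => hM x (Ioc_subset_Icc_self hx)

lemma inner_toLp {G : ℝ → ℝ} (hG : Continuous G) (h : UnitL2) :
    inner ℝ ((continuous_memLp hG).toLp G) h = ∫ x in (0:ℝ)..1, G x * zeroExt h x := by
  rw [inner_eq_integral_zeroExt]
  refine intervalIntegral.integral_congr_ae ?_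
  filter_upwards [zeroExt_ae_eq (continuous_memLp hG).coeFn_toLp] with x hx hxm
  rw [uIoc_of_le zero_le_one] at hxm
  rw [hx, indicator_of_mem hxm]

/-- The bending moment of a weak solution, recovered from the load and the conditions at `1`. -/
noncomputable def momentFn (P : ℝ → ℝ) (α β lam : ℝ) (v : EnergySpace) (s : ℝ) : ℝ :=
  lam * loadPrim P v s - lam * loadPrim P v 1 + lam * loadFn P v 1 * (1 - s)
    - rightBdry α β v - α / β * rightBdry α β v * (1 - s)

lemma momentFn_continuous {P : ℝ → ℝ} (hc : Continuous P) (α β lam : ℝ) (v : EnergySpace) :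
    Continuous (momentFn P α β lam v) := by
  have := loadPrim_continuous hc v
  unfold momentFn
  fun_prop

lemma energyForm_sub_massForm {P : ℝ → ℝ} (hc : Continuous P) (hb : ∀ x, |P x| ≤ 1)
    (h1 : P 1 = 1) (α : ℝ) {β : ℝ} (hβ : β ≠ 0) (lam : ℝ) (v z : EnergySpace) :
    energyForm α β v z - lam * massForm P hc hb v z =
      inner ℝ (v.2.2 - (continuous_memLp (momentFn_continuous hc α β lam v)).toLp _) z.2.2 +
      z.1 * (α / β * (rightBdry α β v - leftBdry α β v) - lam * loadFn P v 1) +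
      z.2.1 * (leftBdry α β v + rightBdry α β v + α / β * rightBdry α β v -
        lam * (loadFn P v 1 - loadPrim P v 1)) := by
  have hWc := loadPrim_continuous hc v
  have hIntg : ∀ f : ℝ → ℝ, Continuous f →
      IntervalIntegrable (fun x => f x * zeroExt z.2.2 x) MeasureTheory.volume 0 1 :=
    fun f hf => (zeroExt_integrable z.2.2).intervalIntegrable.continuousOn_mul hf.continuousOn
  rw [inner_sub_left, inner_toLp (momentFn_continuous hc α β lam v)]
  have hG : ∫ x in (0:ℝ)..1, momentFn P α β lam v x * zeroExt z.2.2 x =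
      lam * (∫ x in (0:ℝ)..1, loadPrim P v x * zeroExt z.2.2 x) +
      ((lam * loadFn P v 1 - α / β * rightBdry α β v) *
        (∫ x in (0:ℝ)..1, (1 - x) * zeroExt z.2.2 x) +
      (- lam * loadPrim P v 1 - rightBdry α β v) * (∫ x in (0:ℝ)..1, 1 * zeroExt z.2.2 x)) := by
    rw [← intervalIntegral.integral_const_mul, ← intervalIntegral.integral_const_mul,
      ← intervalIntegral.integral_const_mul,
      ← intervalIntegral.integral_add ((hIntg _ (by fun_prop)).const_mul _)
        ((hIntg _ (by fun_prop)).const_mul _),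
      ← intervalIntegral.integral_add ((hIntg _ hWc).const_mul _)
        (((hIntg _ (by fun_prop)).const_mul _).add ((hIntg _ (by fun_prop)).const_mul _))]
    congr 1
    funext x
    rw [momentFn]
    ring
  rw [hG, energyForm_apply, massForm_eq_load hc hb h1, leftBdry_apply α β z, rightBdry_apply α β z,
    deflFn_one, slopeFn_one]
  simp only [one_mul]
  field_simp
  ring

lemma weak_iff {P : ℝ → ℝ} (hc : Continuous P) (hb : ∀ x, |P x| ≤ 1)
    (h1 : P 1 = 1) (α : ℝ) {β : ℝ} (hβ : β ≠ 0) (lam : ℝ) (v : EnergySpace) :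
    (∀ z, energyForm α β v z = lam * massForm P hc hb v z) ↔
      (v.2.2 =ᵐ[MeasureTheory.volume.restrict (Ioc (0:ℝ) 1)] momentFn P α β lam v) ∧
      α / β * (rightBdry α β v - leftBdry α β v) - lam * loadFn P v 1 = 0 ∧
      leftBdry α β v + rightBdry α β v + α / β * rightBdry α β v -
        lam * (loadFn P v 1 - loadPrim P v 1) = 0 := by
  have key := energyForm_sub_massForm hc hb h1 α hβ lam v
  have hmem := continuous_memLp (momentFn_continuous hc α β lam v)
  constructor
  · intro h
    refine ⟨?_, ?_, ?_⟩
    · have := key (0, 0, v.2.2 - hmem.toLp _)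
      rw [h, sub_self] at this
      simp only [zero_mul, add_zero] at this
      have h2 := sub_eq_zero.1 (inner_self_eq_zero.1 this.symm)
      rw [h2]
      exact hmem.coeFn_toLp
    · have := key (1, 0, 0)
      rw [h, sub_self] at this
      simpa using this.symm
    · have := key (0, 1, 0)
      rw [h, sub_self] at this
      simpa using this.symm
  · rintro ⟨hg, hE1, hE2⟩ z
    have h2 : v.2.2 = hmem.toLp _ := MeasureTheory.Lp.ext (hg.trans hmem.coeFn_toLp.symm)
    have := key z
    rw [hE1, hE2, sub_eq_zero.2 h2] at this
    simp only [inner_zero_left, mul_zero, add_zero] at this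
    linarith

lemma uniqueDiffOn_unit : UniqueDiffOn ℝ (Icc (0:ℝ) 1) := uniqueDiffOn_Icc zero_lt_one

lemma Y2_eq (y : ℝ → ℝ) : Y2 y = derivWithin (Y1 y) (Icc 0 1) := by
  unfold Y2 Y1
  rw [iteratedDerivWithin_succ, iteratedDerivWithin_one]

lemma Y3_eq (y : ℝ → ℝ) : Y3 y = derivWithin (Y2 y) (Icc 0 1) := by
  unfold Y3 Y2
  rw [iteratedDerivWithin_succ]

/-- A chain of derivatives on `[0,1]` determines the functions `Y1`, `Y2`, `Y3`. -/
lemma contDiffOn_of_deriv_chain {y y1 y2 y3 : ℝ → ℝ}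
    (h1 : ∀ x ∈ Icc (0:ℝ) 1, HasDerivWithinAt y (y1 x) (Icc 0 1) x)
    (h2 : ∀ x ∈ Icc (0:ℝ) 1, HasDerivWithinAt y1 (y2 x) (Icc 0 1) x)
    (h3 : ∀ x ∈ Icc (0:ℝ) 1, HasDerivWithinAt y2 (y3 x) (Icc 0 1) x)
    (hc : ContinuousOn y3 (Icc 0 1)) :
    ContDiffOn ℝ 3 y (Icc 0 1) ∧ EqOn (Y1 y) y1 (Icc 0 1) ∧ EqOn (Y2 y) y2 (Icc 0 1) ∧
      EqOn (Y3 y) y3 (Icc 0 1) := by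
  have e1 : EqOn (Y1 y) y1 (Icc 0 1) := fun x hx => (h1 x hx).derivWithin (uniqueDiffOn_unit x hx)
  have e2 : EqOn (Y2 y) y2 (Icc 0 1) := fun x hx => by
    rw [Y2_eq, derivWithin_congr e1 (e1 hx)]
    exact (h2 x hx).derivWithin (uniqueDiffOn_unit x hx)
  have e3 : EqOn (Y3 y) y3 (Icc 0 1) := fun x hx => by
    rw [Y3_eq, derivWithin_congr e2 (e2 hx)]
    exact (h3 x hx).derivWithin (uniqueDiffOn_unit x hx)
  have d0 : DifferentiableOn ℝ y (Icc 0 1) := fun x hx => (h1 x hx).differentiableWithinAt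
  have d1 : DifferentiableOn ℝ (Y1 y) (Icc 0 1) :=
    DifferentiableOn.congr (fun x hx => (h2 x hx).differentiableWithinAt) e1
  have d2 : DifferentiableOn ℝ (Y2 y) (Icc 0 1) :=
    DifferentiableOn.congr (fun x hx => (h3 x hx).differentiableWithinAt) e2
  refine ⟨?_, e1, e2, e3⟩
  refine contDiffOn_of_continuousOn_differentiableOn_deriv (n := 3) (fun m hm => ?_)
    (fun m hm => ?_)
  · have hm' : m ≤ 3 := by exact_mod_cast hm
    interval_cases m
    · simpa using d0.continuousOn
    · rw [iteratedDerivWithin_one]; exact d1.continuousOn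
    · exact d2.continuousOn
    · exact hc.congr e3
  · have hm' : m < 3 := by exact_mod_cast hm
    interval_cases m
    · simpa using d0
    · rw [iteratedDerivWithin_one]; exact d1
    · exact d2

lemma deriv_chain_of_contDiffOn {y : ℝ → ℝ} (h : ContDiffOn ℝ 3 y (Icc 0 1)) :
    (∀ x ∈ Icc (0:ℝ) 1, HasDerivWithinAt y (Y1 y x) (Icc 0 1) x) ∧
    (∀ x ∈ Icc (0:ℝ) 1, HasDerivWithinAt (Y1 y) (Y2 y x) (Icc 0 1) x) ∧
    (∀ x ∈ Icc (0:ℝ) 1, HasDerivWithinAt (Y2 y) (Y3 y x) (Icc 0 1) x) ∧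
    ContinuousOn (Y3 y) (Icc 0 1) := by
  refine ⟨fun x hx => ?_, fun x hx => ?_, fun x hx => ?_,
    h.continuousOn_iteratedDerivWithin (by norm_num) uniqueDiffOn_unit⟩
  · exact (h.differentiableOn (by norm_num) x hx).hasDerivWithinAt
  · have := h.differentiableOn_iteratedDerivWithin (m := 1) (by norm_num) uniqueDiffOn_unit x hx
    rw [iteratedDerivWithin_one] at this
    rw [Y2_eq]
    exact this.hasDerivWithinAt
  · have := h.differentiableOn_iteratedDerivWithin (m := 2) (by norm_num) uniqueDiffOn_unit x hx
    rw [Y3_eq]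
    exact this.hasDerivWithinAt

lemma eq_add_integral_of_hasDerivWithinAt {f f' : ℝ → ℝ}
    (hf : ∀ x ∈ Icc (0:ℝ) 1, HasDerivWithinAt f (f' x) (Icc 0 1) x)
    (hc : ContinuousOn f' (Icc 0 1)) {x : ℝ} (hx : x ∈ Icc (0:ℝ) 1) :
    f x = f 0 + ∫ t in (0:ℝ)..x, f' t := by
  have hsub : Icc 0 x ⊆ Icc (0:ℝ) 1 := Icc_subset_Icc le_rfl hx.2
  rw [intervalIntegral.integral_eq_sub_of_hasDerivAt_of_le hx.1
    (fun t ht => (hf t (hsub ht)).continuousWithinAt.mono hsub)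
    (fun t ht => (hf t (hsub (Ioo_subset_Icc_self ht))).hasDerivAt
      (Icc_mem_nhds ht.1 (ht.2.trans_le hx.2)))
    ((hc.mono hsub).intervalIntegrable_of_Icc hx.1)]
  ring

lemma integral_congr_unit {f g : ℝ → ℝ} (h : EqOn f g (Icc 0 1)) {x : ℝ}
    (hx : x ∈ Icc (0:ℝ) 1) : ∫ t in (0:ℝ)..x, f t = ∫ t in (0:ℝ)..x, g t := by
  refine intervalIntegral.integral_congr fun t ht => h ?_
  rw [uIcc_of_le hx.1] at ht
  exact ⟨ht.1, ht.2.trans hx.2⟩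

lemma slopeFn_eq_of_ae_eq {v : EnergySpace} {G : ℝ → ℝ}
    (h : v.2.2 =ᵐ[MeasureTheory.volume.restrict (Ioc (0:ℝ) 1)] G) {x : ℝ}
    (hx : x ∈ Icc (0:ℝ) 1) : slopeFn v x = v.2.1 + ∫ t in (0:ℝ)..x, G t := by
  rw [slopeFn]
  congr 1
  refine intervalIntegral.integral_congr_ae ?_
  filter_upwards [zeroExt_ae_eq h] with t ht htm
  rw [uIoc_of_le hx.1] at htm
  rw [ht, indicator_of_mem (show t ∈ Ioc (0:ℝ) 1 from ⟨htm.1, htm.2.trans hx.2⟩)]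

lemma slopeFn_hasDerivWithinAt {v : EnergySpace} {G : ℝ → ℝ} (hG : Continuous G)
    (h : v.2.2 =ᵐ[MeasureTheory.volume.restrict (Ioc (0:ℝ) 1)] G) {x : ℝ}
    (hx : x ∈ Icc (0:ℝ) 1) : HasDerivWithinAt (slopeFn v) (G x) (Icc 0 1) x := by
  have h1 : HasDerivAt (fun x => v.2.1 + ∫ t in (0:ℝ)..x, G t) (G x) x :=
    (hG.integral_hasStrictDerivAt 0 x).hasDerivAt.const_add _
  exact h1.hasDerivWithinAt.congr (fun t ht => slopeFn_eq_of_ae_eq h ht)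
    (slopeFn_eq_of_ae_eq h hx)

lemma eq_zero_of_deflFn_eq_zero {v : EnergySpace} {G : ℝ → ℝ} (hG : Continuous G)
    (h : v.2.2 =ᵐ[MeasureTheory.volume.restrict (Ioc (0:ℝ) 1)] G)
    (hv : ∀ x ∈ Icc (0:ℝ) 1, deflFn v x = 0) : v = 0 := by
  have hs : ∀ x ∈ Icc (0:ℝ) 1, slopeFn v x = 0 := fun x hx => by
    have h1 : HasDerivWithinAt (deflFn v) 0 (Icc 0 1) x :=
      (hasDerivWithinAt_const x _ (0:ℝ)).congr hv (hv x hx)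
    exact (uniqueDiffOn_unit x hx).eq_deriv _ (deflFn_hasDerivAt v x).hasDerivWithinAt h1
  have hg : ∀ x ∈ Icc (0:ℝ) 1, G x = 0 := fun x hx => by
    have h1 : HasDerivWithinAt (slopeFn v) 0 (Icc 0 1) x :=
      (hasDerivWithinAt_const x _ (0:ℝ)).congr hs (hs x hx)
    exact (uniqueDiffOn_unit x hx).eq_deriv _ (slopeFn_hasDerivWithinAt hG h hx) h1
  have h0 : (0:ℝ) ∈ Icc (0:ℝ) 1 := ⟨le_rfl, zero_le_one⟩
  have e1 : v.1 = 0 := by rw [← deflFn_zero]; exact hv 0 h0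
  have e2 : v.2.1 = 0 := by rw [← slopeFn_zero]; exact hs 0 h0
  have e3 : v.2.2 = 0 := by
    refine MeasureTheory.Lp.ext ((h.trans ?_).trans
      (MeasureTheory.Lp.coeFn_zero ℝ 2 _).symm)
    rw [EventuallyEq, MeasureTheory.ae_restrict_iff' measurableSet_Ioc]
    exact Eventually.of_forall fun x hx => hg x (Ioc_subset_Icc_self hx)
  exact Prod.ext e1 (Prod.ext e2 e3)

lemma momentFn_hasDerivAt {P : ℝ → ℝ} (hc : Continuous P) (α β lam : ℝ) (v : EnergySpace) (x : ℝ) :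
    HasDerivAt (momentFn P α β lam v)
      (lam * loadFn P v x - lam * loadFn P v 1 + α / β * rightBdry α β v) x := by
  have h1 := (loadPrim_hasDerivAt hc v x).const_mul lam
  have h2 : HasDerivAt (fun s : ℝ => 1 - s) (-1) x := (hasDerivAt_id x).const_sub 1
  have h3 := (((h1.sub_const (lam * loadPrim P v 1)).add
    (h2.const_mul (lam * loadFn P v 1))).sub_const (rightBdry α β v)).sub
    (h2.const_mul (α / β * rightBdry α β v))
  exact h3.congr_deriv (by ring)

/-- The moment of a weak solution in terms of the data at `0`. -/
lemma momentFn_eq_of_natural {P : ℝ → ℝ} {α β lam : ℝ} {v : EnergySpace}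
    (hE1 : α / β * (rightBdry α β v - leftBdry α β v) - lam * loadFn P v 1 = 0)
    (hE2 : leftBdry α β v + rightBdry α β v + α / β * rightBdry α β v -
        lam * (loadFn P v 1 - loadPrim P v 1) = 0) (s : ℝ) :
    momentFn P α β lam v s =
      leftBdry α β v + α / β * leftBdry α β v * s + lam * loadPrim P v s := by
  rw [momentFn]
  linear_combination s * hE1 - hE2

lemma isEigenvalue_of_weak {P : ℝ → ℝ} (hc : Continuous P) (hb : ∀ x, |P x| ≤ 1) (h0 : P 0 = 0)
    (h1 : P 1 = 1) {α β lam : ℝ} (hβ : 0 < β) {v : EnergySpace} (hv : v ≠ 0)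
    (hw : ∀ z, energyForm α β v z = lam * massForm P hc hb v z) : IsEigenvalue P α β lam := by
  obtain ⟨hg, hE1, hE2⟩ := (weak_iff hc hb h1 α hβ.ne' lam v).1 hw
  have hGc := momentFn_continuous hc α β lam v
  have hlc := loadFn_continuous hc v
  obtain ⟨hC, e1, e2, e3⟩ := contDiffOn_of_deriv_chain
    (y2 := momentFn P α β lam v)
    (y3 := fun x => lam * loadFn P v x - lam * loadFn P v 1 + α / β * rightBdry α β v)
    (fun x _ => (deflFn_hasDerivAt v x).hasDerivWithinAt)
    (fun x hx => slopeFn_hasDerivWithinAt hGc hg hx)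
    (fun x _ => (momentFn_hasDerivAt hc α β lam v x).hasDerivWithinAt)
    (by fun_prop)
  have m0 : (0:ℝ) ∈ Icc (0:ℝ) 1 := ⟨le_rfl, zero_le_one⟩
  have m1 : (1:ℝ) ∈ Icc (0:ℝ) 1 := ⟨zero_le_one, le_rfl⟩
  refine ⟨deflFn v, ?_, ⟨hC, fun x hx => ?_⟩, ?_, ?_, ?_, ?_⟩
  · by_contra hne
    exact hv (eq_zero_of_deflFn_eq_zero hGc hg fun x hx => by
      by_contra hx'
      exact hne ⟨x, hx, hx'⟩)
  · rw [e1 hx]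
    have h2 : HasDerivAt (fun t => - lam * (∫ s in (0:ℝ)..t, P s * slopeFn v s) +
        (α / β * rightBdry α β v - lam * loadFn P v 1)) (-(lam * P x * slopeFn v x)) x :=
      (((hasDerivAt_integral_slopeFn hc v x).const_mul (-lam)).add_const _).congr_deriv (by ring)
    refine h2.hasDerivWithinAt.congr (fun t ht => ?_) ?_
    · rw [e3 ht]; simp only [loadFn]; ring
    · rw [e3 hx]; simp only [loadFn]; ring
  · rw [e1 m0, e2 m0, momentFn_eq_of_natural hE1 hE2, loadPrim_zero, leftBdry_apply, deflFn_zero,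
      slopeFn_zero]
    ring
  · simp only [e3 m0, e2 m0, momentFn_eq_of_natural hE1 hE2, loadPrim_zero, loadFn_zero h0]
    have hdiv : β * (α / β) = α := by field_simp
    linear_combination -β * hE1 - leftBdry α β v * hdiv
  · rw [e1 m1, e2 m1, momentFn, rightBdry_apply]
    ring
  · simp only [e3 m1, e2 m1, momentFn]
    field_simp
    ring

lemma weak_of_isEigenvalue {P : ℝ → ℝ} (hc : Continuous P) (hb : ∀ x, |P x| ≤ 1) (h0 : P 0 = 0)
    (h1 : P 1 = 1) {α β lam : ℝ} (hβ : 0 < β) (h : IsEigenvalue P α β lam) :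
    ∃ v : EnergySpace, v ≠ 0 ∧ ∀ z, energyForm α β v z = lam * massForm P hc hb v z := by
  obtain ⟨y, ⟨x₀, hx₀, hne⟩, ⟨hC, hsol⟩, b1, b2, b3, b4⟩ := h
  obtain ⟨d1, d2, d3, c3⟩ := deriv_chain_of_contDiffOn hC
  have m0 : (0:ℝ) ∈ Icc (0:ℝ) 1 := ⟨le_rfl, zero_le_one⟩
  have m1 : (1:ℝ) ∈ Icc (0:ℝ) 1 := ⟨zero_le_one, le_rfl⟩
  have c0 : ContinuousOn y (Icc 0 1) := fun x hx => (d1 x hx).continuousWithinAt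
  have c1 : ContinuousOn (Y1 y) (Icc 0 1) := fun x hx => (d2 x hx).continuousWithinAt
  have c2 : ContinuousOn (Y2 y) (Icc 0 1) := fun x hx => (d3 x hx).continuousWithinAt
  have hmem : MeasureTheory.MemLp (Y2 y) 2 (MeasureTheory.volume.restrict (Ioc (0:ℝ) 1)) := by
    obtain ⟨M, hM⟩ := isCompact_Icc.exists_bound_of_continuousOn c2
    refine MeasureTheory.MemLp.of_bound
      ((c2.mono Ioc_subset_Icc_self).aestronglyMeasurable measurableSet_Ioc) M ?_
    rw [MeasureTheory.ae_restrict_iff' measurableSet_Ioc]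
    exact Eventually.of_forall fun x hx => hM x (Ioc_subset_Icc_self hx)
  set v : EnergySpace := (y 0, Y1 y 0, hmem.toLp _) with hvdef
  have hg : v.2.2 =ᵐ[MeasureTheory.volume.restrict (Ioc (0:ℝ) 1)] Y2 y := hmem.coeFn_toLp
  have es : EqOn (slopeFn v) (Y1 y) (Icc 0 1) := fun x hx => by
    rw [slopeFn_eq_of_ae_eq hg hx, eq_add_integral_of_hasDerivWithinAt d2 c2 hx]
  have ed : EqOn (deflFn v) y (Icc 0 1) := fun x hx => by
    rw [deflFn, integral_congr_unit es hx, eq_add_integral_of_hasDerivWithinAt d1 c1 hx]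
  have e3 : EqOn (Y3 y) (fun x => Y3 y 0 + lam * loadFn P v x) (Icc 0 1) := fun x hx => by
    have h2 := eq_add_integral_of_hasDerivWithinAt hsol
      (((continuousOn_const.mul hc.continuousOn).mul c1).neg) hx
    have h3 : ∫ t in (0:ℝ)..x, -(lam * P t * Y1 y t) =
        -lam * ∫ t in (0:ℝ)..x, P t * slopeFn v t := by
      rw [← intervalIntegral.integral_const_mul]
      refine integral_congr_unit (fun t ht => ?_) hx
      simp only [es ht]
      ring
    rw [h3, h0] at h2
    simp only [loadFn, ed hx]
    linear_combination h2
  have e2 : EqOn (Y2 y) (fun x => Y2 y 0 + Y3 y 0 * x + lam * loadPrim P v x) (Icc 0 1) :=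
    fun x hx => by
    have h2 := eq_add_integral_of_hasDerivWithinAt d3 c3 hx
    rw [integral_congr_unit e3 hx, intervalIntegral.integral_add (by simp)
      (((loadFn_continuous hc v).intervalIntegrable _ _).const_mul _),
      intervalIntegral.integral_const_mul, intervalIntegral.integral_const] at h2
    rw [h2]
    simp only [loadPrim, sub_zero, smul_eq_mul]
    ring
  have hL : leftBdry α β v = Y2 y 0 := by
    rw [leftBdry_apply]
    linear_combination -b1
  have hR : rightBdry α β v = -Y2 y 1 := by
    rw [rightBdry_apply, es m1, ed m1]
    linear_combination b3
  have hY0 : α / β * Y2 y 0 = Y3 y 0 := by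
    field_simp
    linear_combination b2
  have hY1 : α / β * Y2 y 1 = - Y3 y 1 := by
    field_simp
    linear_combination -b4
  have f3 := e3 m1
  have f2 := e2 m1
  simp only [mul_one] at f2 f3
  have hE1 : α / β * (rightBdry α β v - leftBdry α β v) - lam * loadFn P v 1 = 0 := by
    rw [hL, hR]
    linear_combination f3 - hY0 - hY1
  have hE2 : leftBdry α β v + rightBdry α β v + α / β * rightBdry α β v -
      lam * (loadFn P v 1 - loadPrim P v 1) = 0 := by
    rw [hL, hR]
    linear_combination f3 - f2 - hY1
  refine ⟨v, fun hv0 => hne ?_, (weak_iff hc hb h1 α hβ.ne' lam v).2 ⟨hg.trans ?_, hE1, hE2⟩⟩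
  · rw [← ed hx₀, hv0, ← zero_smul ℝ (0 : EnergySpace), deflFn_smul, zero_mul]
  · rw [EventuallyEq, MeasureTheory.ae_restrict_iff' measurableSet_Ioc]
    refine Eventually.of_forall fun x hx => ?_
    rw [momentFn_eq_of_natural hE1 hE2, hL, hY0]
    exact e2 (Ioc_subset_Icc_self hx)

lemma isEigenvalue_iff_mem_pencilEigenvalues {P : ℝ → ℝ} (hc : Continuous P)
    (hb : ∀ x, |P x| ≤ 1) (h0 : P 0 = 0) (h1 : P 1 = 1) {α β lam : ℝ} (hβ : 0 < β) :
    IsEigenvalue P α β lam ↔ lam ∈ pencilEigenvalues (energyForm α β) (massForm P hc hb) :=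
  ⟨weak_of_isEigenvalue hc hb h0 h1 hβ, fun ⟨_, hv, hw⟩ =>
    isEigenvalue_of_weak hc hb h0 h1 hβ hv hw⟩

/-- A weak solution whose Cauchy data at `0` vanish is zero. -/
lemma eq_zero_of_initial_data {P : ℝ → ℝ} (hc : Continuous P) (hb : ∀ x, |P x| ≤ 1)
    {lam : ℝ} {v : EnergySpace}
    (hg : v.2.2 =ᵐ[MeasureTheory.volume.restrict (Ioc (0:ℝ) 1)] fun x => lam * loadPrim P v x)
    (h1 : v.1 = 0) (h2 : v.2.1 = 0) : v = 0 := by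
  have hGc : Continuous fun x => lam * loadPrim P v x := (loadPrim_continuous hc v).const_mul lam
  let F : ℝ → ℝ := fun x => ∫ t in (0:ℝ)..x, P t * slopeFn v t
  have hF : ∀ x, HasDerivAt F (P x * slopeFn v x) x := hasDerivAt_integral_slopeFn hc v
  let f : ℝ → ℝ × ℝ × ℝ × ℝ := fun x => (deflFn v x, slopeFn v x, loadPrim P v x, F x)
  let f' : ℝ → ℝ × ℝ × ℝ × ℝ := fun x =>
    (slopeFn v x, lam * loadPrim P v x, loadFn P v x, P x * slopeFn v x)
  have hf : ∀ x ∈ Icc (0:ℝ) 1, HasDerivWithinAt f (f' x) (Icc 0 1) x := fun x hx =>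
    (deflFn_hasDerivAt v x).hasDerivWithinAt.prodMk
      ((slopeFn_hasDerivWithinAt hGc hg hx).prodMk
        ((loadPrim_hasDerivAt hc v x).hasDerivWithinAt.prodMk (hF x).hasDerivWithinAt))
  have hbound : ∀ x, ‖f' x‖ ≤ (2 + |lam|) * ‖f x‖ := by
    intro x
    have n1 : |deflFn v x| ≤ ‖f x‖ := norm_fst_le (f x)
    have n2 : |slopeFn v x| ≤ ‖f x‖ := (norm_fst_le (f x).2).trans (norm_snd_le (f x))
    have n3 : |loadPrim P v x| ≤ ‖f x‖ := (norm_fst_le (f x).2.2).trans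
      ((norm_snd_le (f x).2).trans (norm_snd_le (f x)))
    have n4 : |F x| ≤ ‖f x‖ := (norm_snd_le (f x).2.2).trans
      ((norm_snd_le (f x).2).trans (norm_snd_le (f x)))
    have hn := norm_nonneg (f x)
    have hP : ∀ a : ℝ, |P x * a| ≤ |a| := fun a => by
      rw [abs_mul]; exact mul_le_of_le_one_left (abs_nonneg _) (hb x)
    have hl : 0 ≤ |lam| * ‖f x‖ := by positivity
    refine norm_prod_le_iff.2 ⟨?_, norm_prod_le_iff.2 ⟨?_, norm_prod_le_iff.2 ⟨?_, ?_⟩⟩⟩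
    · change |slopeFn v x| ≤ _
      linarith
    · change |lam * loadPrim P v x| ≤ _
      rw [abs_mul]
      linarith [mul_le_mul_of_nonneg_left n3 (abs_nonneg lam)]
    · change |P x * deflFn v x - F x| ≤ _
      linarith [abs_sub (P x * deflFn v x) (F x), hP (deflFn v x)]
    · change |P x * slopeFn v x| ≤ _
      linarith [hP (slopeFn v x)]
  have hf0 : f 0 = 0 := by
    have e1 : deflFn v 0 = 0 := by rw [deflFn_zero, h1]
    have e2 : slopeFn v 0 = 0 := by rw [slopeFn_zero, h2]
    have e4 : F 0 = 0 := intervalIntegral.integral_same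
    exact Prod.ext e1 (Prod.ext e2 (Prod.ext (loadPrim_zero P v) e4))
  have hzero := eq_zero_of_abs_deriv_le_mul_abs_self_of_eq_zero_right
    (fun x hx => (hf x hx).continuousWithinAt)
    (fun x hx => ((hf x (Ico_subset_Icc_self hx)).mono_of_mem_nhdsWithin
      (Icc_mem_nhdsGE_of_mem hx))) hf0 (fun x _ => hbound x)
  exact eq_zero_of_deflFn_eq_zero hGc hg fun x hx => congrArg Prod.fst (hzero x hx)

/-- Nonnegativity of the load as long as the slope of a function vanishing at `0` is. -/
lemma loadFn_nonneg {P : ℝ → ℝ} (hc : Continuous P) (hm : Monotone P) {v : EnergySpace}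
    (h1 : v.1 = 0) {s : ℝ} (hs0 : 0 ≤ s) (hs : ∀ t ∈ Icc 0 s, 0 ≤ slopeFn v t) :
    0 ≤ loadFn P v s := by
  have hv := slopeFn_continuous v
  have h : loadFn P v s = ∫ t in (0:ℝ)..s, (P s - P t) * slopeFn v t := by
    rw [loadFn, deflFn, h1, zero_add, ← intervalIntegral.integral_const_mul,
      ← intervalIntegral.integral_sub (Continuous.intervalIntegrable (by fun_prop) _ _)
        (Continuous.intervalIntegrable (by fun_prop) _ _)]
    congr 1
    funext t
    ring
  rw [h]
  exact intervalIntegral.integral_nonneg hs0 fun t ht =>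
    mul_nonneg (sub_nonneg.2 (hm ht.2)) (hs t ht)

lemma loadPrim_nonneg {P : ℝ → ℝ} (hc : Continuous P) (hm : Monotone P) {v : EnergySpace}
    (h1 : v.1 = 0) {s : ℝ} (hs0 : 0 ≤ s) (hs : ∀ t ∈ Icc 0 s, 0 ≤ slopeFn v t) :
    0 ≤ loadPrim P v s :=
  intervalIntegral.integral_nonneg hs0 fun _ ht => loadFn_nonneg hc hm h1 ht.1
    fun _ hr => hs _ ⟨hr.1, hr.2.trans ht.2⟩

/-- For a nonnegative spectral parameter no weak solution vanishes at `0` with positive slope. -/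
lemma slope_nonpos_of_weak {P : ℝ → ℝ} (hc : Continuous P) (hb : ∀ x, |P x| ≤ 1) (hm : Monotone P)
    (hP1 : P 1 = 1) {α β lam : ℝ} (hα : 0 ≤ α) (hβ : 0 < β) (hlam : 0 ≤ lam) {v : EnergySpace}
    (hw : ∀ z, energyForm α β v z = lam * massForm P hc hb v z) (h1 : v.1 = 0) : v.2.1 ≤ 0 := by
  by_contra! hd
  obtain ⟨hg, hE1, hE2⟩ := (weak_iff hc hb hP1 α hβ.ne' lam v).1 hw
  have hL : leftBdry α β v = β * v.2.1 := by rw [leftBdry_apply, h1]; ring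
  have hM : ∀ s ∈ Icc (0:ℝ) 1, (∀ t ∈ Icc 0 s, 0 ≤ slopeFn v t) →
      0 < momentFn P α β lam v s := by
    intro s hs hslope
    rw [momentFn_eq_of_natural hE1 hE2, hL]
    have e1 := mul_nonneg hlam (loadPrim_nonneg hc hm h1 hs.1 hslope)
    have e2 : 0 < β * v.2.1 := by positivity
    have e3 : 0 ≤ α / β * (β * v.2.1) * s := mul_nonneg (by positivity) hs.1
    linarith
  have hmono : ∀ s ∈ Icc (0:ℝ) 1, (∀ t ∈ Ico 0 s, 0 ≤ slopeFn v t) → v.2.1 ≤ slopeFn v s := by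
    intro s hs hslope
    have : ∀ t ∈ Ioo 0 s, 0 ≤ momentFn P α β lam v t := fun t ht =>
      (hM t ⟨ht.1.le, ht.2.le.trans hs.2⟩ fun r hr => hslope r ⟨hr.1, hr.2.trans_lt ht.2⟩).le
    rw [slopeFn_eq_of_ae_eq hg hs]
    have h2 := intervalIntegral.integral_nonneg_of_ae_restrict (μ := MeasureTheory.volume) hs.1
      (f := momentFn P α β lam v) (by
        rw [EventuallyLE, MeasureTheory.ae_restrict_iff' measurableSet_Icc]
        have e0 : ∀ᵐ x : ℝ, x ≠ 0 := by simp [MeasureTheory.ae_iff]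
        have es : ∀ᵐ x : ℝ, x ≠ s := by simp [MeasureTheory.ae_iff]
        filter_upwards [e0, es] with x hx0 hxs hx
        exact this x ⟨lt_of_le_of_ne hx.1 (Ne.symm hx0), lt_of_le_of_ne hx.2 hxs⟩)
    linarith
  have hpos : ∀ t ∈ Icc (0:ℝ) 1, 0 < slopeFn v t := by
    by_contra! hne
    obtain ⟨x, hx, hx0⟩ := hne
    have hcpt : IsCompact (Icc (0:ℝ) 1 ∩ slopeFn v ⁻¹' Iic 0) :=
      isCompact_Icc.inter_right (isClosed_Iic.preimage (slopeFn_continuous v))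
    obtain ⟨m, ⟨hm1, hm2⟩, hleast⟩ := hcpt.exists_isLeast ⟨x, hx, hx0⟩
    have := hmono m hm1 fun t ht => by
      by_contra! hneg
      exact absurd (hleast ⟨⟨ht.1, ht.2.le.trans hm1.2⟩, hneg.le⟩) (not_le.2 ht.2)
    exact absurd (hd.trans_le this) (not_lt.2 hm2)
  have m1 : (1:ℝ) ∈ Icc (0:ℝ) 1 := ⟨zero_le_one, le_rfl⟩
  have hM1 := hM 1 m1 fun t ht => (hpos t ht).le
  have hd1 : 0 ≤ deflFn v 1 := by
    rw [deflFn, h1, zero_add]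
    exact intervalIntegral.integral_nonneg zero_le_one fun t ht => (hpos t ht).le
  have hR : 0 ≤ rightBdry α β v := by
    rw [rightBdry_apply]
    exact add_nonneg (mul_nonneg hβ.le (hpos 1 m1).le) (mul_nonneg hα hd1)
  rw [momentFn] at hM1
  linarith

/-- A weak solution vanishing at `0` is zero. -/
lemma eq_zero_of_weak {P : ℝ → ℝ} (hc : Continuous P) (hb : ∀ x, |P x| ≤ 1) (hm : Monotone P)
    (hP0 : P 0 = 0) (hP1 : P 1 = 1) {α β lam : ℝ} (hα : 0 ≤ α) (hβ : 0 < β) {v : EnergySpace}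
    (hw : ∀ z, energyForm α β v z = lam * massForm P hc hb v z) (h1 : v.1 = 0) : v = 0 := by
  rcases lt_or_ge lam 0 with hlam | hlam
  · obtain ⟨c, hc0, hcoer⟩ := energyForm_coercive hc hb hm hP0 hP1 hα hβ
    have e1 := energyForm_nonneg α hβ v
    have e2 := massForm_nonneg hc hb hm hP0 hP1 v
    have e3 := hw v
    have e4 : massForm P hc hb v v = 0 := by nlinarith
    have e5 := hcoer v
    rw [e3, e4, mul_zero, add_zero] at e5
    have e6 : ‖v‖ ^ 2 ≤ 0 := by
      by_contra! hne
      exact absurd e5 (not_le.2 (mul_pos hc0 hne))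
    exact norm_eq_zero.1 (pow_eq_zero_iff two_ne_zero |>.1 (le_antisymm e6 (sq_nonneg _)))
  · have hd1 := slope_nonpos_of_weak hc hb hm hP1 hα hβ hlam hw h1
    have hd2 := slope_nonpos_of_weak hc hb hm hP1 hα hβ hlam (v := -v)
      (fun z => by rw [map_neg, map_neg, neg_apply, neg_apply, hw, mul_neg])
      (show -v.1 = 0 by rw [h1, neg_zero])
    have hd : v.2.1 = 0 := le_antisymm hd1 (by have : -v.2.1 ≤ 0 := hd2; linarith)
    obtain ⟨hg, hE1, hE2⟩ := (weak_iff hc hb hP1 α hβ.ne' lam v).1 hw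
    refine eq_zero_of_initial_data hc hb (lam := lam) ?_ h1 hd
    refine hg.trans (Eventually.of_forall fun x => ?_)
    simp only [momentFn_eq_of_natural hE1 hE2, leftBdry_apply, h1, hd]
    ring

/-- The boundary functionals of two problems taken together. -/
noncomputable def bdryMap (α₁ β₁ α₂ β₂ : ℝ) : EnergySpace →ₗ[ℝ] (Fin 4 → ℝ) :=
  LinearMap.pi ![leftBdry α₁ β₁, rightBdry α₁ β₁, leftBdry α₂ β₂, rightBdry α₂ β₂]

lemma energyForm_eq_of_bdryMap_eq_zero {α₁ β₁ α₂ β₂ : ℝ} {v : EnergySpace}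
    (h : bdryMap α₁ β₁ α₂ β₂ v = 0) : energyForm α₂ β₂ v v = energyForm α₁ β₁ v v := by
  have h0 : leftBdry α₁ β₁ v = 0 := congrFun h 0
  have h1 : rightBdry α₁ β₁ v = 0 := congrFun h 1
  have h2 : leftBdry α₂ β₂ v = 0 := congrFun h 2
  have h3 : rightBdry α₂ β₂ v = 0 := congrFun h 3
  rw [energyForm_apply, energyForm_apply, h0, h1, h2, h3]
  ring

lemma isEigenvalue_ncard_le {P : ℝ → ℝ} (hc : Continuous P) (hb : ∀ x, |P x| ≤ 1)
    (hm : Monotone P) (h0 : P 0 = 0) (h1 : P 1 = 1) {α₁ β₁ α₂ β₂ : ℝ} (hα₁ : 0 ≤ α₁) (hβ₁ : 0 < β₁)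
    (hα₂ : 0 ≤ α₂) (hβ₂ : 0 < β₂) {L : ℝ} (hL : 0 < L) :
    {μ : ℝ | IsEigenvalue P α₁ β₁ μ ∧ μ ≤ L}.ncard ≤
      {μ : ℝ | IsEigenvalue P α₂ β₂ μ ∧ μ ≤ L}.ncard + 4 := by
  obtain ⟨c₁, hc₁, hac₁⟩ := energyForm_coercive hc hb hm h0 h1 hα₁ hβ₁
  obtain ⟨c₂, hc₂, hac₂⟩ := energyForm_coercive hc hb hm h0 h1 hα₂ hβ₂
  simp only [isEigenvalue_iff_mem_pencilEigenvalues hc hb h0 h1 hβ₁,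
    isEigenvalue_iff_mem_pencilEigenvalues hc hb h0 h1 hβ₂]
  exact pencil_ncard_le _ _ _ (massForm_symm hc hb) (energyForm_symm α₁ β₁)
    (energyForm_symm α₂ β₂) (massForm_nonneg hc hb hm h0 h1) hc₁ hac₁ hc₂ hac₂
    (massForm_formCompact hc hb) (bdryMap α₁ β₁ α₂ β₂)
    (fun _ => energyForm_eq_of_bdryMap_eq_zero) (LinearMap.fst ℝ ℝ (ℝ × UnitL2))
    (fun _ _ => eq_zero_of_weak hc hb hm h0 h1 hα₂ hβ₂) hL

lemma solutionOn_congr {P P' : ℝ → ℝ} (h : EqOn P P' (Icc 0 1)) (lam : ℝ) (y : ℝ → ℝ) :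
    SolutionOn P lam y ↔ SolutionOn P' lam y := by
  refine and_congr_right fun _ => forall₂_congr fun x hx => ?_
  rw [h hx]
  exact ⟨fun H => H.congr (fun t ht => by rw [h ht]) (by rw [h hx]),
    fun H => H.congr (fun t ht => by rw [h ht]) (by rw [h hx])⟩

lemma isEigenvalue_congr {P P' : ℝ → ℝ} (h : EqOn P P' (Icc 0 1)) (α β lam : ℝ) :
    IsEigenvalue P α β lam ↔ IsEigenvalue P' α β lam :=
  exists_congr fun y => and_congr_right fun _ => and_congr_left fun _ => solutionOn_congr h lam y

theorem stmt15 (P : ℝ → ℝ) (κ : ℕ) (a : ℝ) (hP : CantorSelfSimilar P κ a)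
    (α₁ β₁ α₂ β₂ : ℝ) (hα₁ : 0 ≤ α₁) (hβ₁ : 0 < β₁) (hα₂ : 0 ≤ α₂) (hβ₂ : 0 < β₂) :
    ∀ lam : ℝ, 0 < lam →
      |({μ : ℝ | IsEigenvalue P α₁ β₁ μ ∧ μ ≤ lam}.ncard : ℤ) -
        ({μ : ℝ | IsEigenvalue P α₂ β₂ μ ∧ μ ≤ lam}.ncard : ℤ)| ≤ 4 := by
  intro lam hlam
  obtain ⟨hcont, hmono, h0, h1, -⟩ := hP
  have m0 : (0:ℝ) ∈ Icc (0:ℝ) 1 := ⟨le_rfl, zero_le_one⟩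
  have m1 : (1:ℝ) ∈ Icc (0:ℝ) 1 := ⟨zero_le_one, le_rfl⟩
  let P' : ℝ → ℝ := IccExtend (zero_le_one' ℝ) fun x => P x
  have heq : EqOn P P' (Icc 0 1) := fun x hx =>
    (IccExtend_of_mem (zero_le_one' ℝ) (fun x => P x) hx).symm
  have hc : Continuous P' :=
    (hcont.comp_continuous continuous_subtype_val fun x => x.2).Icc_extend'
  have hm : Monotone P' := Monotone.IccExtend (h := zero_le_one' ℝ) (f := fun x => P x)
    fun x y hxy => hmono x.2 y.2 hxy
  have hb : ∀ x, |P' x| ≤ 1 := fun x => by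
    have hx := (projIcc (0:ℝ) 1 zero_le_one x).2
    have e1 := hmono m0 hx hx.1
    have e2 := hmono hx m1 hx.2
    rw [h0] at e1
    rw [h1] at e2
    exact (abs_of_nonneg e1).trans_le e2
  have h0' : P' 0 = 0 := (heq m0).symm.trans h0
  have h1' : P' 1 = 1 := (heq m1).symm.trans h1
  simp only [isEigenvalue_congr heq]
  have e1 := isEigenvalue_ncard_le hc hb hm h0' h1' hα₁ hβ₁ hα₂ hβ₂ hlam
  have e2 := isEigenvalue_ncard_le hc hb hm h0' h1' hα₂ hβ₂ hα₁ hβ₁ hlam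
  rw [abs_le]
  omega
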